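/- arXiv:2204.06805 — 8 statements merged into one kernel-verified Lean document; each statement's English description precedes it below -/
import Mathlib

section
/- Let K be a finite field of characteristic 3 and let ζ be a fixed generator of the multiplicative group K^×. Let F = x y z³ + f₂ z² + f₁ z + f₀ ∈ K[x,y,z], where f₂, f₁, f₀ ∈ K[x,y] are homogeneous of degrees 3, 4, 5 respectively. Then there exist M ∈ GL₃(K) and a nonzero λ ∈ K such that λ·(F∘M) = x y z³ + (a₁x³ + a₂x²y + a₃xy² + a₄y³)z² + (a₅x⁴ + a₆x³y + a₇x²y² + a₈xy³ + a₉y⁴)z + a₁₀x⁵ + a₁₁x⁴y + a₁₂x³y² + a₁₃x²y³ + a₁₄xy⁴ + a₁₅y⁵ for some a₁, …, a₁₅ ∈ K satisfying one of the following: (1) a₁ = 1, a₂ ∈ {0,1}, and a₅ = a₆ = 0; (2) a₁ = 0, a₂ = 1, a₃ ∈ {0,1}, and a₆ = a₇ = 0; (3) a₁ = a₂ = 0, a₃ = 1, a₄ ∈ {0,1}, and a₇ = a₈ = 0; (4) a₁ = a₂ = a₃ = 0, a₄ = 1, and a₈ = a₉ = 0; (5) a₁ = a₂ = a₃ = a₄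 = 0, a₆ ∈ {0, 1, ζ}, and a₇ ∈ {0,1}. -/
open MvPolynomial

/-- The polynomial obtained from `F` by the invertible linear change of variables
given by the matrix `M`, i.e. `F ∘ M`. -/
noncomputable def changeVars {K : Type*} [Field K] (M : Matrix (Fin 3) (Fin 3) K)
    (F : MvPolynomial (Fin 3) K) : MvPolynomial (Fin 3) K :=
  aeval (fun i => ∑ j : Fin 3, C (M i j) * X j) F

lemma binary_form_decomp {K : Type*} [Field K] (n : ℕ) (f : MvPolynomial (Fin 3) K)
    (h : f.IsHomogeneous n) (hv : (2 : Fin 3) ∉ f.vars) :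
    ∃ c : ℕ → K, f = ∑ i ∈ Finset.range (n + 1), C (c i) * X 0 ^ (n - i) * X 1 ^ i := by
  classical
  let g : ℕ → (Fin 3 →₀ ℕ) := fun i => Finsupp.single 0 (n - i) + Finsupp.single 1 i
  have hg1 : ∀ i, g i 1 = i := by intro i; simp [g]
  have hginj : Function.Injective g := by
    intro i j hij
    rw [← hg1 i, ← hg1 j, hij]
  refine ⟨fun i => coeff (g i) f, ?_⟩
  have hsub : f.support ⊆ (Finset.range (n + 1)).image g := by
    intro m hm
    have hdeg := h (mem_support_iff.mp hm)
    have hm2 : m 2 = 0 := by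
      by_contra h2
      exact hv ((mem_vars 2).mpr ⟨m, hm, Finsupp.mem_support_iff.mpr h2⟩)
    have hsum : m 0 + m 1 = n := by
      rw [Finsupp.weight_apply, Finsupp.sum_fintype _ _ (by simp)] at hdeg
      simp [Fin.sum_univ_three, hm2] at hdeg
      exact hdeg
    refine Finset.mem_image.mpr ⟨m 1, Finset.mem_range.mpr (by omega), ?_⟩
    ext i
    fin_cases i
    · simp [g]; omega
    · simp [g]
    · simp [g, hm2]
  conv_lhs => rw [f.as_sum]
  rw [Finset.sum_subset hsub (by
    intro m _ hm
    rw [notMem_support_iff.mp hm, monomial_zero]),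
    Finset.sum_image (fun i _ j _ hij => hginj hij)]
  refine Finset.sum_congr rfl fun i _ => ?_
  rw [X_pow_eq_monomial, X_pow_eq_monomial, C_mul_monomial, monomial_mul]
  simp [g]

/-- `t ↦ c t²` can be normalised to `0`, `1` or `ζ`. -/
lemma square_normalise {K : Type*} [Field K] (ζ : Kˣ)
    (hζ : ∀ u : Kˣ, u ∈ Subgroup.zpowers ζ) (c : K) :
    ∃ t : K, t ≠ 0 ∧ (c * t ^ 2 = 0 ∨ c * t ^ 2 = 1 ∨ c * t ^ 2 = (ζ : K)) := by
  by_cases hc : c = 0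
  · exact ⟨1, one_ne_zero, Or.inl (by simp [hc])⟩
  obtain ⟨k, hk⟩ := Subgroup.mem_zpowers_iff.mp (hζ (Units.mk0 c hc))
  rcases Int.even_or_odd' k with ⟨m, hm | hm⟩
  · refine ⟨((ζ ^ (-m) : Kˣ) : K), Units.ne_zero _, Or.inr (Or.inl ?_)⟩
    have : Units.mk0 c hc * (ζ ^ (-m)) ^ 2 = 1 := by
      rw [← hk, hm, ← zpow_natCast, ← zpow_mul, ← zpow_add]
      simp [mul_comm]
    simpa using congrArg (Units.val) this
  · refine ⟨((ζ ^ (-m) : Kˣ) : K), Units.ne_zero _, Or.inr (Or.inr ?_)⟩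
    have : Units.mk0 c hc * (ζ ^ (-m)) ^ 2 = ζ := by
      rw [← hk, hm, ← zpow_natCast, ← zpow_mul, ← zpow_add]
      have : 2 * m + 1 + -m * ((2 : ℕ) : ℤ) = 1 := by push_cast; ring
      rw [this, zpow_one]
    simpa using congrArg (Units.val) this

/-- Explicit effect of the substitution `x ↦ p x, y ↦ q y, z ↦ r x + s y + g z`. -/
lemma substitution_effect {K : Type*} [Field K] [CharP K 3] (b c d : ℕ → K)
    (p q g r s : K) (hp : p ≠ 0) (hq : q ≠ 0) (hg : g ≠ 0)
    (F : MvPolynomial (Fin 3) K)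
    (hF : F = X 0 * X 1 * X 2 ^ 3
      + (∑ i ∈ Finset.range (3 + 1), C (b i) * X 0 ^ (3 - i) * X 1 ^ i) * X 2 ^ 2
      + (∑ i ∈ Finset.range (4 + 1), C (c i) * X 0 ^ (4 - i) * X 1 ^ i) * X 2
      + ∑ i ∈ Finset.range (5 + 1), C (d i) * X 0 ^ (5 - i) * X 1 ^ i)
    (l : K) (hl : l * (p * q * g ^ 3) = 1) :
    ∃ (M : GL (Fin 3) K) (a : Fin 16 → K),
      C l * changeVars (M : Matrix (Fin 3) (Fin 3) K) F =
        X 0 * X 1 * X 2 ^ 3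
        + (C (a 1) * X 0 ^ 3 + C (a 2) * X 0 ^ 2 * X 1 + C (a 3) * X 0 * X 1 ^ 2
            + C (a 4) * X 1 ^ 3) * X 2 ^ 2
        + (C (a 5) * X 0 ^ 4 + C (a 6) * X 0 ^ 3 * X 1 + C (a 7) * X 0 ^ 2 * X 1 ^ 2
            + C (a 8) * X 0 * X 1 ^ 3 + C (a 9) * X 1 ^ 4) * X 2
        + C (a 10) * X 0 ^ 5 + C (a 11) * X 0 ^ 4 * X 1 + C (a 12) * X 0 ^ 3 * X 1 ^ 2
        + C (a 13) * X 0 ^ 2 * X 1 ^ 3 + C (a 14) * X 0 * X 1 ^ 4 + C (a 15) * X 1 ^ 5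
      ∧ a 1 = l * (b 0 * (p ^ 3 * q ^ 0) * g ^ 2)
      ∧ a 2 = l * (b 1 * (p ^ 2 * q ^ 1) * g ^ 2)
      ∧ a 3 = l * (b 2 * (p ^ 1 * q ^ 2) * g ^ 2)
      ∧ a 4 = l * (b 3 * (p ^ 0 * q ^ 3) * g ^ 2)
      ∧ a 5 = l * ((c 0 * (p ^ 4 * q ^ 0) + 2 * b 0 * (p ^ 3 * q ^ 0) * r) * g)
      ∧ a 6 = l * ((c 1 * (p ^ 3 * q ^ 1) + 2 * b 0 * (p ^ 3 * q ^ 0) * s + 2 * b 1 * (p ^ 2 * q ^ 1) * r) * g)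
      ∧ a 7 = l * ((c 2 * (p ^ 2 * q ^ 2) + 2 * b 1 * (p ^ 2 * q ^ 1) * s + 2 * b 2 * (p ^ 1 * q ^ 2) * r) * g)
      ∧ a 8 = l * ((c 3 * (p ^ 1 * q ^ 3) + 2 * b 2 * (p ^ 1 * q ^ 2) * s + 2 * b 3 * (p ^ 0 * q ^ 3) * r) * g)
      ∧ a 9 = l * ((c 4 * (p ^ 0 * q ^ 4) + 2 * b 3 * (p ^ 0 * q ^ 3) * s) * g) := by
  have hdet : (!![p, 0, 0; 0, q, 0; r, s, g] : Matrix (Fin 3) (Fin 3) K).det ≠ 0 := by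
    simp [Matrix.det_fin_three, hp, hq, hg]
  refine ⟨Matrix.GeneralLinearGroup.mkOfDetNeZero _ hdet, ![0, l * (b 0 * (p ^ 3 * q ^ 0) * g ^ 2),
      l * (b 1 * (p ^ 2 * q ^ 1) * g ^ 2),
      l * (b 2 * (p ^ 1 * q ^ 2) * g ^ 2),
      l * (b 3 * (p ^ 0 * q ^ 3) * g ^ 2),
      l * ((c 0 * (p ^ 4 * q ^ 0) + 2 * b 0 * (p ^ 3 * q ^ 0) * r) * g),
      l * ((c 1 * (p ^ 3 * q ^ 1) + 2 * b 0 * (p ^ 3 * q ^ 0) * s + 2 * b 1 * (p ^ 2 * q ^ 1) * r) * g),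
      l * ((c 2 * (p ^ 2 * q ^ 2) + 2 * b 1 * (p ^ 2 * q ^ 1) * s + 2 * b 2 * (p ^ 1 * q ^ 2) * r) * g),
      l * ((c 3 * (p ^ 1 * q ^ 3) + 2 * b 2 * (p ^ 1 * q ^ 2) * s + 2 * b 3 * (p ^ 0 * q ^ 3) * r) * g),
      l * ((c 4 * (p ^ 0 * q ^ 4) + 2 * b 3 * (p ^ 0 * q ^ 3) * s) * g),
      l * (d 0 * (p ^ 5 * q ^ 0) + c 0 * (p ^ 4 * q ^ 0) * r + b 0 * (p ^ 3 * q ^ 0) * r ^ 2),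
      l * (d 1 * (p ^ 4 * q ^ 1) + c 0 * (p ^ 4 * q ^ 0) * s + c 1 * (p ^ 3 * q ^ 1) * r + 2 * b 0 * (p ^ 3 * q ^ 0) * r * s + b 1 * (p ^ 2 * q ^ 1) * r ^ 2 + p * q * r ^ 3),
      l * (d 2 * (p ^ 3 * q ^ 2) + c 1 * (p ^ 3 * q ^ 1) * s + c 2 * (p ^ 2 * q ^ 2) * r + b 0 * (p ^ 3 * q ^ 0) * s ^ 2 + 2 * b 1 * (p ^ 2 * q ^ 1) * r * s + b 2 * (p ^ 1 * q ^ 2) * r ^ 2),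
      l * (d 3 * (p ^ 2 * q ^ 3) + c 2 * (p ^ 2 * q ^ 2) * s + c 3 * (p ^ 1 * q ^ 3) * r + b 1 * (p ^ 2 * q ^ 1) * s ^ 2 + 2 * b 2 * (p ^ 1 * q ^ 2) * r * s + b 3 * (p ^ 0 * q ^ 3) * r ^ 2),
      l * (d 4 * (p ^ 1 * q ^ 4) + c 3 * (p ^ 1 * q ^ 3) * s + c 4 * (p ^ 0 * q ^ 4) * r + b 2 * (p ^ 1 * q ^ 2) * s ^ 2 + 2 * b 3 * (p ^ 0 * q ^ 3) * r * s + p * q * s ^ 3),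
      l * (d 5 * (p ^ 0 * q ^ 5) + c 4 * (p ^ 0 * q ^ 4) * s + b 3 * (p ^ 0 * q ^ 3) * s ^ 2)],
    ?_, rfl, rfl, rfl, rfl, rfl, rfl, rfl, rfl, rfl⟩
  have h3 : (3 : MvPolynomial (Fin 3) K) = 0 := by
    have h : (3 : K) = 0 := by exact_mod_cast CharP.cast_eq_zero K 3
    rw [← map_ofNat (C : K →+* MvPolynomial (Fin 3) K) 3, h, C_0]
  have hl' : (C l * (C p * C q * C g ^ 3) : MvPolynomial (Fin 3) K) = 1 := by
    have := congrArg (C : K → MvPolynomial (Fin 3) K) hl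
    simpa using this
  have hcv : changeVars ((Matrix.GeneralLinearGroup.mkOfDetNeZero _ hdet : GL (Fin 3) K) :
      Matrix (Fin 3) (Fin 3) K) F = C p * X 0 * (C q * X 1) * (C r * X 0 + C s * X 1 + C g * X 2) ^ 3
      + (∑ i ∈ Finset.range (3 + 1), C (b i) * (C p * X 0) ^ (3 - i) * (C q * X 1) ^ i)
        * (C r * X 0 + C s * X 1 + C g * X 2) ^ 2
      + (∑ i ∈ Finset.range (4 + 1), C (c i) * (C p * X 0) ^ (4 - i) * (C q * X 1) ^ i)
        * (C r * X 0 + C s * X 1 + C g * X 2)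
      + ∑ i ∈ Finset.range (5 + 1), C (d i) * (C p * X 0) ^ (5 - i) * (C q * X 1) ^ i := by
    subst hF
    simp [changeVars, Matrix.GeneralLinearGroup.mkOfDetNeZero, Fin.sum_univ_three,
      algebraMap_eq]
  have hcube : (C r * X 0 + C s * X 1 + C g * X 2 : MvPolynomial (Fin 3) K) ^ 3
      = C r ^ 3 * X 0 ^ 3 + C s ^ 3 * X 1 ^ 3 + C g ^ 3 * X 2 ^ 3 := by
    linear_combination ((C r * X 0 + C s * X 1) * (C s * X 1 + C g * X 2)
      * (C r * X 0 + C g * X 2)) * h3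
  rw [hcv, hcube]
  simp only [Finset.sum_range_succ, Finset.sum_range_zero]
  simp only [Matrix.cons_val, C_mul, C_add, C_pow]
  have h2 : (C (2 : K) : MvPolynomial (Fin 3) K) = 2 := map_ofNat (C : K →+* MvPolynomial (Fin 3) K) 2
  simp only [h2]
  norm_num only
  linear_combination (X 0 * X 1 * X 2 ^ 3) * hl'

/-- Reduction of plane quintic models of genus-five trigonal curves with a split node,
over a finite field `K` of characteristic 3 with `ζ` a generator of `K^×`. -/
theorem trigonal_reduction_split_node
    {K : Type*} [Field K] [Fintype K] [CharP K 3]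
    (ζ : Kˣ) (hζ : ∀ u : Kˣ, u ∈ Subgroup.zpowers ζ)
    (f₂ f₁ f₀ : MvPolynomial (Fin 3) K)
    (h₂ : f₂.IsHomogeneous 3) (h₁ : f₁.IsHomogeneous 4) (h₀ : f₀.IsHomogeneous 5)
    (hv₂ : (2 : Fin 3) ∉ f₂.vars) (hv₁ : (2 : Fin 3) ∉ f₁.vars) (hv₀ : (2 : Fin 3) ∉ f₀.vars)
    (F : MvPolynomial (Fin 3) K)
    (hF : F = X 0 * X 1 * X 2 ^ 3 + f₂ * X 2 ^ 2 + f₁ * X 2 + f₀) :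
    ∃ (M : GL (Fin 3) K) (lam : K) (a : Fin 16 → K), lam ≠ 0 ∧
      C lam * changeVars (M : Matrix (Fin 3) (Fin 3) K) F =
        X 0 * X 1 * X 2 ^ 3
        + (C (a 1) * X 0 ^ 3 + C (a 2) * X 0 ^ 2 * X 1 + C (a 3) * X 0 * X 1 ^ 2
            + C (a 4) * X 1 ^ 3) * X 2 ^ 2
        + (C (a 5) * X 0 ^ 4 + C (a 6) * X 0 ^ 3 * X 1 + C (a 7) * X 0 ^ 2 * X 1 ^ 2
            + C (a 8) * X 0 * X 1 ^ 3 + C (a 9) * X 1 ^ 4) * X 2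
        + C (a 10) * X 0 ^ 5 + C (a 11) * X 0 ^ 4 * X 1 + C (a 12) * X 0 ^ 3 * X 1 ^ 2
        + C (a 13) * X 0 ^ 2 * X 1 ^ 3 + C (a 14) * X 0 * X 1 ^ 4 + C (a 15) * X 1 ^ 5
      ∧ ((a 1 = 1 ∧ (a 2 = 0 ∨ a 2 = 1) ∧ a 5 = 0 ∧ a 6 = 0)
        ∨ (a 1 = 0 ∧ a 2 = 1 ∧ (a 3 = 0 ∨ a 3 = 1) ∧ a 6 = 0 ∧ a 7 = 0)
        ∨ (a 1 = 0 ∧ a 2 = 0 ∧ a 3 = 1 ∧ (a 4 = 0 ∨ a 4 = 1) ∧ a 7 = 0 ∧ a 8 = 0)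
        ∨ (a 1 = 0 ∧ a 2 = 0 ∧ a 3 = 0 ∧ a 4 = 1 ∧ a 8 = 0 ∧ a 9 = 0)
        ∨ (a 1 = 0 ∧ a 2 = 0 ∧ a 3 = 0 ∧ a 4 = 0
            ∧ (a 6 = 0 ∨ a 6 = 1 ∨ a 6 = (ζ : K)) ∧ (a 7 = 0 ∨ a 7 = 1))) := by
  obtain ⟨b, hb⟩ := binary_form_decomp 3 f₂ h₂ hv₂
  obtain ⟨c, hc⟩ := binary_form_decomp 4 f₁ h₁ hv₁
  obtain ⟨d, hd⟩ := binary_form_decomp 5 f₀ h₀ hv₀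
  rw [hb, hc, hd] at hF
  have h3 : (3 : K) = 0 := by exact_mod_cast CharP.cast_eq_zero K 3
  have h2 : (2 : K) = -1 := by linear_combination h3
  have h6 : (6 : K) = 0 := by linear_combination 2 * h3
  have h9 : (9 : K) = 0 := by linear_combination 3 * h3
  by_cases hb0 : b 0 = 0
  swap
  · by_cases hb1 : b 1 = 0
    · have hp : (1 : K) ≠ 0 := one_ne_zero
      have hq : (b 0 : K) ≠ 0 := hb0
      have hg : (1 : K) ≠ 0 := one_ne_zero
      have hne := (mul_ne_zero (mul_ne_zero hp hq) (pow_ne_zero 3 hg))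
      obtain ⟨M, a, hM, e1, e2, e3, e4, e5, e6, e7, e8, e9⟩ := substitution_effect b c d (1) (b 0) (1)
        (1 * (c 0 / b 0)) (b 0 * ((c 1 + 2 * b 1 * (c 0 / b 0)) / b 0)) hp hq hg F hF _ (inv_mul_cancel₀ hne)
      refine ⟨M, _, a, inv_ne_zero hne, hM, Or.inl ⟨?_, Or.inl ?_, ?_, ?_⟩⟩
      · rw [e1]; field_simp
      · rw [e2]; simp [hb1]
      · rw [e5]; refine mul_eq_zero_of_right _ ?_
        field_simp; (try simp only [h2]); ring_nf; (try simp [h3, h6, h9])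
      · rw [e6]; refine mul_eq_zero_of_right _ ?_
        field_simp; (try simp only [h2]); ring_nf; (try simp [h3, h6, h9])
    · have hp : (1 : K) ≠ 0 := one_ne_zero
      have hq : (b 0 / b 1 : K) ≠ 0 := by simp [hb0, hb1]
      have hg : (b 1 : K) ≠ 0 := hb1
      have hne := (mul_ne_zero (mul_ne_zero hp hq) (pow_ne_zero 3 hg))
      obtain ⟨M, a, hM, e1, e2, e3, e4, e5, e6, e7, e8, e9⟩ := substitution_effect b c d (1) (b 0 / b 1) (b 1)
        (1 * (c 0 / b 0)) (b 0 / b 1 * ((c 1 + 2 * b 1 * (c 0 / b 0)) / b 0)) hp hq hg F hF _ (inv_mul_cancel₀ hne)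
      refine ⟨M, _, a, inv_ne_zero hne, hM, Or.inl ⟨?_, Or.inr ?_, ?_, ?_⟩⟩
      · rw [e1]; field_simp
      · rw [e2]; field_simp
      · rw [e5]; refine mul_eq_zero_of_right _ ?_
        field_simp; (try simp only [h2]); ring_nf; (try simp [h3, h6, h9])
      · rw [e6]; refine mul_eq_zero_of_right _ ?_
        field_simp; (try simp only [h2]); ring_nf; (try simp [h3, h6, h9])
  by_cases hb1 : b 1 = 0
  swap
  · by_cases hb2 : b 2 = 0
    · have hp : (1 : K) ≠ 0 := one_ne_zero
      have hq : (1 : K) ≠ 0 := one_ne_zero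
      have hg : (b 1 : K) ≠ 0 := hb1
      have hne := (mul_ne_zero (mul_ne_zero hp hq) (pow_ne_zero 3 hg))
      obtain ⟨M, a, hM, e1, e2, e3, e4, e5, e6, e7, e8, e9⟩ := substitution_effect b c d (1) (1) (b 1)
        (1 * (c 1 / b 1)) (1 * ((c 2 + 2 * b 2 * (c 1 / b 1)) / b 1)) hp hq hg F hF _ (inv_mul_cancel₀ hne)
      refine ⟨M, _, a, inv_ne_zero hne, hM, Or.inr (Or.inl ⟨?_, ?_, Or.inl ?_, ?_, ?_⟩)⟩
      · rw [e1]; simp [hb0]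
      · rw [e2]; field_simp
      · rw [e3]; simp [hb2]
      · rw [e6]; refine mul_eq_zero_of_right _ ?_
        (try simp only [hb0]); field_simp; (try simp only [h2]); ring_nf; (try simp [h3, h6, h9])
      · rw [e7]; refine mul_eq_zero_of_right _ ?_
        (try simp only [hb0]); field_simp; (try simp only [h2]); ring_nf; (try simp [h3, h6, h9])
    · have hp : (1 : K) ≠ 0 := one_ne_zero
      have hq : (b 1 / b 2 : K) ≠ 0 := by simp [hb1, hb2]
      have hg : (b 1 : K) ≠ 0 := hb1
      have hne := (mul_ne_zero (mul_ne_zero hp hq) (pow_ne_zero 3 hg))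
      obtain ⟨M, a, hM, e1, e2, e3, e4, e5, e6, e7, e8, e9⟩ := substitution_effect b c d (1) (b 1 / b 2) (b 1)
        (1 * (c 1 / b 1)) (b 1 / b 2 * ((c 2 + 2 * b 2 * (c 1 / b 1)) / b 1)) hp hq hg F hF _ (inv_mul_cancel₀ hne)
      refine ⟨M, _, a, inv_ne_zero hne, hM, Or.inr (Or.inl ⟨?_, ?_, Or.inr ?_, ?_, ?_⟩)⟩
      · rw [e1]; simp [hb0]
      · rw [e2]; field_simp
      · rw [e3]; field_simp
      · rw [e6]; refine mul_eq_zero_of_right _ ?_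
        (try simp only [hb0]); field_simp; (try simp only [h2]); ring_nf; (try simp [h3, h6, h9])
      · rw [e7]; refine mul_eq_zero_of_right _ ?_
        (try simp only [hb0]); field_simp; (try simp only [h2]); ring_nf; (try simp [h3, h6, h9])
  by_cases hb2 : b 2 = 0
  swap
  · by_cases hb3 : b 3 = 0
    · have hp : (1 : K) ≠ 0 := one_ne_zero
      have hq : (1 : K) ≠ 0 := one_ne_zero
      have hg : (b 2 : K) ≠ 0 := hb2
      have hne := (mul_ne_zero (mul_ne_zero hp hq) (pow_ne_zero 3 hg))
      obtain ⟨M, a, hM, e1, e2, e3, e4, e5, e6, e7, e8, e9⟩ := substitution_effect b c d (1) (1) (b 2)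
        (1 * (c 2 / b 2)) (1 * ((c 3 + 2 * b 3 * (c 2 / b 2)) / b 2)) hp hq hg F hF _ (inv_mul_cancel₀ hne)
      refine ⟨M, _, a, inv_ne_zero hne, hM, Or.inr (Or.inr (Or.inl ⟨?_, ?_, ?_, Or.inl ?_, ?_, ?_⟩))⟩
      · rw [e1]; simp [hb0]
      · rw [e2]; simp [hb1]
      · rw [e3]; field_simp
      · rw [e4]; simp [hb3]
      · rw [e7]; refine mul_eq_zero_of_right _ ?_
        (try simp only [hb0, hb1]); field_simp; (try simp only [h2]); ring_nf; (try simp [h3, h6, h9])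
      · rw [e8]; refine mul_eq_zero_of_right _ ?_
        (try simp only [hb0, hb1]); field_simp; (try simp only [h2]); ring_nf; (try simp [h3, h6, h9])
    · have hp : (b 3 / b 2 : K) ≠ 0 := by simp [hb3, hb2]
      have hq : (1 : K) ≠ 0 := one_ne_zero
      have hg : (b 2 : K) ≠ 0 := hb2
      have hne := (mul_ne_zero (mul_ne_zero hp hq) (pow_ne_zero 3 hg))
      obtain ⟨M, a, hM, e1, e2, e3, e4, e5, e6, e7, e8, e9⟩ := substitution_effect b c d (b 3 / b 2) (1) (b 2)
        (b 3 / b 2 * (c 2 / b 2)) (1 * ((c 3 + 2 * b 3 * (c 2 / b 2)) / b 2)) hp hq hg F hF _ (inv_mul_cancel₀ hne)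
      refine ⟨M, _, a, inv_ne_zero hne, hM, Or.inr (Or.inr (Or.inl ⟨?_, ?_, ?_, Or.inr ?_, ?_, ?_⟩))⟩
      · rw [e1]; simp [hb0]
      · rw [e2]; simp [hb1]
      · rw [e3]; field_simp
      · rw [e4]; field_simp
      · rw [e7]; refine mul_eq_zero_of_right _ ?_
        (try simp only [hb0, hb1]); field_simp; (try simp only [h2]); ring_nf; (try simp [h3, h6, h9])
      · rw [e8]; refine mul_eq_zero_of_right _ ?_
        (try simp only [hb0, hb1]); field_simp; (try simp only [h2]); ring_nf; (try simp [h3, h6, h9])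
  by_cases hb3 : b 3 = 0
  swap
  · have hp : (1 : K) ≠ 0 := one_ne_zero
    have hq : (1 : K) ≠ 0 := one_ne_zero
    have hg : (b 3 : K) ≠ 0 := hb3
    have hne := (mul_ne_zero (mul_ne_zero hp hq) (pow_ne_zero 3 hg))
    obtain ⟨M, a, hM, e1, e2, e3, e4, e5, e6, e7, e8, e9⟩ := substitution_effect b c d (1) (1) (b 3)
      (1 * (c 3 / b 3)) (1 * ((c 4 + 2 * 0 * (c 3 / b 3)) / b 3)) hp hq hg F hF _ (inv_mul_cancel₀ hne)
    refine ⟨M, _, a, inv_ne_zero hne, hM, Or.inr (Or.inr (Or.inr (Or.inl ⟨?_, ?_, ?_, ?_, ?_, ?_⟩)))⟩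
    · rw [e1]; simp [hb0]
    · rw [e2]; simp [hb1]
    · rw [e3]; simp [hb2]
    · rw [e4]; field_simp
    · rw [e8]; refine mul_eq_zero_of_right _ ?_
      (try simp only [hb0, hb1, hb2]); field_simp; (try simp only [h2]); ring_nf; (try simp [h3, h6, h9])
    · rw [e9]; refine mul_eq_zero_of_right _ ?_
      (try simp only [hb0, hb1, hb2]); field_simp; (try simp only [h2]); ring_nf; (try simp [h3, h6, h9])
  obtain ⟨t, ht, ht'⟩ := square_normalise ζ hζ (c 1)
  by_cases hc2 : c 2 = 0
  · have hp : (t : K) ≠ 0 := ht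
    have hq : (1 : K) ≠ 0 := one_ne_zero
    have hg : (1 : K) ≠ 0 := one_ne_zero
    have hne := (mul_ne_zero (mul_ne_zero hp hq) (pow_ne_zero 3 hg))
    obtain ⟨M, a, hM, e1, e2, e3, e4, e5, e6, e7, e8, e9⟩ := substitution_effect b c d (t) (1) (1)
      (0) (0) hp hq hg F hF _ (inv_mul_cancel₀ hne)
    refine ⟨M, _, a, inv_ne_zero hne, hM, Or.inr (Or.inr (Or.inr (Or.inr ⟨?_, ?_, ?_, ?_, ?_, Or.inl ?_⟩)))⟩
    · rw [e1]; simp [hb0]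
    · rw [e2]; simp [hb1]
    · rw [e3]; simp [hb2]
    · rw [e4]; simp [hb3]
    · have e6' : a 6 = c 1 * t ^ 2 := by
        rw [e6]; simp only [hb0, hb1]; field_simp; try ring
      rw [e6']; exact ht'
    · rw [e7]; simp [hc2]
  · have hp : (t : K) ≠ 0 := ht
    have hq : ((c 2 * t)⁻¹ : K) ≠ 0 := by simp [hc2, ht]
    have hg : (1 : K) ≠ 0 := one_ne_zero
    have hne := (mul_ne_zero (mul_ne_zero hp hq) (pow_ne_zero 3 hg))
    obtain ⟨M, a, hM, e1, e2, e3, e4, e5, e6, e7, e8, e9⟩ := substitution_effect b c d (t) ((c 2 * t)⁻¹) (1)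
      (0) (0) hp hq hg F hF _ (inv_mul_cancel₀ hne)
    refine ⟨M, _, a, inv_ne_zero hne, hM, Or.inr (Or.inr (Or.inr (Or.inr ⟨?_, ?_, ?_, ?_, ?_, Or.inr ?_⟩)))⟩
    · rw [e1]; simp [hb0]
    · rw [e2]; simp [hb1]
    · rw [e3]; simp [hb2]
    · rw [e4]; simp [hb3]
    · have e6' : a 6 = c 1 * t ^ 2 := by
        rw [e6]; simp only [hb0, hb1]; field_simp; try ring
      rw [e6']; exact ht'
    · rw [e7]; simp only [hb1, hb2]; field_simp; try ring
end

section
/- Let K be a finite field of characteristic 3 and let ε ∈ K be a nonzero element that is not a square in K. Let F = (x² − εy²) z³ + f₂ z² + f₁ z + f₀ ∈ K[x,y,z], where f₂, f₁, f₀ ∈ K[x,y] are homogeneous of degrees 3, 4, 5 respectively. Then there exist M ∈ GL₃(K) and a nonzero λ ∈ K such that λ·(F∘M) has one of the following forms, for some elements a_i ∈ K: (1) (x²−εy²)z³ + (a₁·x(x²−εy²) + a₂x³ + y³)z² + (a₃x⁴ + a₄x³y + a₅x²y²)z + a₆x⁵ + a₇x⁴y + a₈x³y² + a₉x²y³ +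 a₁₀xy⁴ + a₁₁y⁵; (2) (x²−εy²)z³ + (x(x²−εy²) + a₁x³)z² + (a₂x⁴ + a₃x³y + a₄y⁴)z + a₅x⁵ + a₆x⁴y + a₇x³y² + a₈x²y³ + a₉xy⁴ + a₁₀y⁵; (3) (x²−εy²)z³ + x³z² + (a₁x²y² + a₂xy³ + a₃y⁴)z + a₄x⁵ + a₅x⁴y + a₆x³y² + a₇x²y³ + a₈xy⁴ + a₉y⁵; (4) (x²−εy²)z³ + (a₁x⁴ + a₂x³y + a₃x²y² + a₄xy³ + a₅y⁴)z + a₆x⁵ + a₇x⁴y + a₈x³y² + a₉x²y³ + a₁₀xy⁴ + a₁₁y⁵, where in case (4) either a₆ = a₇ = a₈ = a₉ = a₁₀ = a₁₁ = 0, or the first nonzero coefficient among a₆, a₇, a₈, a₉, a₁₀, a₁₁ equals 1. -/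
open MvPolynomial

set_option maxHeartbeats 1000000

def BinForm {K : Type*} [Field K] (n : ℕ) (f : MvPolynomial (Fin 3) K) : Prop :=
  f.IsHomogeneous n ∧ f ∈ supported K ({0, 1} : Set (Fin 3))

theorem BinForm.exists_coeff {K : Type*} [Field K] {n : ℕ} {f : MvPolynomial (Fin 3) K}
    (h : BinForm n f) : ∃ c : ℕ → K,
      f = ∑ i ∈ Finset.range (n + 1), C (c i) * (X 0 ^ (n - i) * X 1 ^ i) := by
  obtain ⟨h1, h2⟩ := h
  rw [mem_supported] at h2
  have key : ∀ m ∈ f.support, ∃ c : ℕ → K,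
      monomial m (coeff m f) = ∑ i ∈ Finset.range (n + 1), C (c i) * (X 0 ^ (n - i) * X 1 ^ i) := by
    intro m hm
    have hdeg : m 0 + m 1 + m 2 = n := by
      have := h1 (mem_support_iff.mp hm)
      rw [← this]
      simp [Finsupp.weight_apply, Finsupp.sum_fintype, Fin.sum_univ_three]
    have hm2 : m 2 = 0 := by
      by_contra hne
      have : (2 : Fin 3) ∈ f.vars := by
        rw [mem_vars_iff_mem_support]
        exact ⟨m, hm, by simpa using hne⟩
      have := h2 this
      simp at this
    refine ⟨fun i => if i = m 1 then coeff m f else 0, ?_⟩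
    rw [Finset.sum_eq_single (m 1)]
    · rw [monomial_eq, Finsupp.prod_fintype _ _ (by simp), Fin.prod_univ_three]
      simp [hm2, show n - m 1 = m 0 by omega]
    · intro b _ hb
      simp [hb]
    · intro hb
      simp at hb
      omega
  choose! c hc using key
  refine ⟨fun i => ∑ m ∈ f.support, c m i, ?_⟩
  conv_lhs => rw [f.as_sum]
  rw [Finset.sum_congr rfl hc, Finset.sum_comm]
  refine Finset.sum_congr rfl fun i _ => ?_
  rw [map_sum, Finset.sum_mul]

theorem binForm_of {K : Type*} [Field K] {n : ℕ} {f : MvPolynomial (Fin 3) K}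
    (h : f.IsHomogeneous n) (hv : (2 : Fin 3) ∉ f.vars) : BinForm n f := by
  refine ⟨h, ?_⟩
  rw [mem_supported]
  intro i hi
  fin_cases i
  · simp
  · simp
  · exact absurd hi hv

theorem BinForm.add {K : Type*} [Field K] {n : ℕ} {f g : MvPolynomial (Fin 3) K}
    (hf : BinForm n f) (hg : BinForm n g) : BinForm n (f + g) :=
  ⟨hf.1.add hg.1, add_mem hf.2 hg.2⟩

theorem BinForm.mul {K : Type*} [Field K] {n m : ℕ} {f g : MvPolynomial (Fin 3) K}
    (hf : BinForm n f) (hg : BinForm m g) : BinForm (n + m) (f * g) :=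
  ⟨hf.1.mul hg.1, mul_mem hf.2 hg.2⟩

theorem binForm_C {K : Type*} [Field K] (a : K) : BinForm 0 (C a : MvPolynomial (Fin 3) K) :=
  ⟨isHomogeneous_C _ _, Subalgebra.algebraMap_mem _ a⟩

theorem binForm_X0 {K : Type*} [Field K] : BinForm 1 (X 0 : MvPolynomial (Fin 3) K) :=
  ⟨isHomogeneous_X _ _, X_mem_supported.mpr (by simp)⟩

theorem binForm_X1 {K : Type*} [Field K] : BinForm 1 (X 1 : MvPolynomial (Fin 3) K) :=
  ⟨isHomogeneous_X _ _, X_mem_supported.mpr (by simp)⟩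

theorem binForm_lin {K : Type*} [Field K] (r s : K) :
    BinForm 1 (C r * X 0 + C s * X 1 : MvPolynomial (Fin 3) K) := by
  have h0 := (binForm_C r).mul binForm_X0
  have h1 := (binForm_C s).mul binForm_X1
  rw [zero_add] at h0 h1
  exact h0.add h1

/-- The similitude `x ↦ p x + ε q y`, `y ↦ q x + p y`. -/
noncomputable def rot {K : Type*} [Field K] (ε p q : K) :
    MvPolynomial (Fin 3) K →ₐ[K] MvPolynomial (Fin 3) K :=
  aeval ![C p * X 0 + C (ε * q) * X 1, C q * X 0 + C p * X 1, 0]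

theorem BinForm.aeval_eq {K : Type*} [Field K] {n : ℕ} {f : MvPolynomial (Fin 3) K}
    (h : BinForm n f) (ε p q : K) (g : Fin 3 → MvPolynomial (Fin 3) K)
    (h0 : g 0 = C p * X 0 + C (ε * q) * X 1) (h1 : g 1 = C q * X 0 + C p * X 1) :
    aeval g f = rot ε p q f := by
  obtain ⟨c, rfl⟩ := h.exists_coeff
  simp [rot, h0, h1]

theorem BinForm.rot {K : Type*} [Field K] {n : ℕ} {f : MvPolynomial (Fin 3) K}
    (h : BinForm n f) (ε p q : K) : BinForm n (rot ε p q f) := by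
  have h' := h.exists_coeff
  rw [← h.aeval_eq ε p q ![C p * X 0 + C (ε * q) * X 1, C q * X 0 + C p * X 1,
    C p * X 0 + C (ε * q) * X 1] rfl rfl]
  have hg : ∀ i, BinForm 1 ((![C p * X 0 + C (ε * q) * X 1, C q * X 0 + C p * X 1,
    C p * X 0 + C (ε * q) * X 1] : Fin 3 → MvPolynomial (Fin 3) K) i) := by
    intro i
    fin_cases i <;> exact binForm_lin _ _
  constructor
  · simpa using h.1.aeval _ (fun i => (hg i).1)
  · obtain ⟨c, hc⟩ := h'
    rw [hc, map_sum]
    refine sum_mem fun i _ => ?_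
    generalize (![C p * X 0 + C (ε * q) * X 1, C q * X 0 + C p * X 1,
      C p * X 0 + C (ε * q) * X 1] : Fin 3 → MvPolynomial (Fin 3) K) = v at hg ⊢
    simp only [map_mul, map_pow, aeval_X, aeval_C]
    exact mul_mem (Subalgebra.algebraMap_mem _ _)
      (mul_mem (pow_mem (hg 0).2 _) (pow_mem (hg 1).2 _))

/-- Cleared-denominator form of the effect of the general substitution. -/
theorem subst_form {K : Type*} [Field K] [CharP K 3] (ε p q r s t : K)
    (hN : p ^ 2 - ε * q ^ 2 ≠ 0) (ht : t ≠ 0)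
    {f₂ f₁ f₀ : MvPolynomial (Fin 3) K}
    (h₂ : BinForm 3 f₂) (h₁ : BinForm 4 f₁) (h₀ : BinForm 5 f₀) :
    ∃ (M : GL (Fin 3) K) (lam : K), lam ≠ 0 ∧ ∃ g : MvPolynomial (Fin 3) K, BinForm 5 g ∧
      (r = 0 → s = 0 → g = C (((p ^ 2 - ε * q ^ 2) * t ^ 3)⁻¹) * rot ε p q f₀) ∧
      C lam * changeVars (M : Matrix (Fin 3) (Fin 3) K)
        ((X 0 ^ 2 - C ε * X 1 ^ 2) * X 2 ^ 3 + f₂ * X 2 ^ 2 + f₁ * X 2 + f₀) =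
      (X 0 ^ 2 - C ε * X 1 ^ 2) * X 2 ^ 3
        + (C (((p ^ 2 - ε * q ^ 2) * t)⁻¹) * rot ε p q f₂) * X 2 ^ 2
        + (C (((p ^ 2 - ε * q ^ 2) * t ^ 2)⁻¹) *
            (rot ε p q f₁ - (C r * X 0 + C s * X 1) * rot ε p q f₂)) * X 2
        + g := by
  have h3 : (3 : MvPolynomial (Fin 3) K) = 0 := by
    have := CharP.cast_eq_zero (MvPolynomial (Fin 3) K) 3
    exact_mod_cast this
  have hdet : (!![p, ε * q, 0; q, p, 0; r, s, t] : Matrix (Fin 3) (Fin 3) K).det ≠ 0 := by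
    rw [Matrix.det_fin_three]
    simp
    have : p * p * t - ε * q * q * t = (p ^ 2 - ε * q ^ 2) * t := by ring
    rw [this]
    exact mul_ne_zero hN ht
  refine ⟨Matrix.GeneralLinearGroup.mkOfDetNeZero _ hdet, ((p ^ 2 - ε * q ^ 2) * t ^ 3)⁻¹,
    by positivity, ?_⟩
  set N := p ^ 2 - ε * q ^ 2 with hNdef
  set l : MvPolynomial (Fin 3) K := C r * X 0 + C s * X 1 with hl
  have hlb : BinForm 1 l := binForm_lin r s
  have hQ : BinForm 2 (X 0 ^ 2 - C ε * X 1 ^ 2 : MvPolynomial (Fin 3) K) := by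
    have e : (X 0 ^ 2 - C ε * X 1 ^ 2 : MvPolynomial (Fin 3) K)
      = X 0 * X 0 + C (-ε) * (X 1 * X 1) := by simp; ring
    rw [e]
    refine (binForm_X0.mul binForm_X0).add ?_
    simpa using (binForm_C (-ε)).mul (binForm_X1.mul binForm_X1)
  refine ⟨C ((N * t ^ 3)⁻¹) * (rot ε p q f₀ + l * rot ε p q f₁ + l * (l * rot ε p q f₂)
    + C N * ((X 0 ^ 2 - C ε * X 1 ^ 2) * (l * (l * l)))), ?_, ?_, ?_⟩
  · have A := h₀.rot ε p q
    have B := hlb.mul (h₁.rot ε p q)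
    have D := hlb.mul (hlb.mul (h₂.rot ε p q))
    have E := (binForm_C N).mul (hQ.mul (hlb.mul (hlb.mul hlb)))
    have := (binForm_C ((N * t ^ 3)⁻¹)).mul (((A.add B).add D).add E)
    simpa using this
  · intro hr hs
    simp [hl, hr, hs]
  · simp only [changeVars, map_add, map_mul, map_sub, map_pow, aeval_X, aeval_C]
    have hM : ((Matrix.GeneralLinearGroup.mkOfDetNeZero _ hdet : GL (Fin 3) K) :
        Matrix (Fin 3) (Fin 3) K) = !![p, ε * q, 0; q, p, 0; r, s, t] := rfl
    have hg0 : ∑ j : Fin 3, C (((Matrix.GeneralLinearGroup.mkOfDetNeZero _ hdet : GL (Fin 3) K) : Matrix (Fin 3) (Fin 3) K) 0 j) * X j =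
        C p * X 0 + C (ε * q) * (X 1 : MvPolynomial (Fin 3) K) := by
      rw [hM]
      simp [Fin.sum_univ_three]
    have hg1 : ∑ j : Fin 3, C (((Matrix.GeneralLinearGroup.mkOfDetNeZero _ hdet : GL (Fin 3) K) : Matrix (Fin 3) (Fin 3) K) 1 j) * X j =
        C q * X 0 + C p * (X 1 : MvPolynomial (Fin 3) K) := by
      rw [hM]
      simp [Fin.sum_univ_three]
    have hg2 : ∑ j : Fin 3, C (((Matrix.GeneralLinearGroup.mkOfDetNeZero _ hdet : GL (Fin 3) K) : Matrix (Fin 3) (Fin 3) K) 2 j) * X j =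
        l + C t * (X 2 : MvPolynomial (Fin 3) K) := by
      rw [hM]
      simp [Fin.sum_univ_three, hl]
    rw [h₂.aeval_eq ε p q _ hg0 hg1, h₁.aeval_eq ε p q _ hg0 hg1, h₀.aeval_eq ε p q _ hg0 hg1,
      hg0, hg1, hg2]
    generalize rot ε p q f₂ = F2
    generalize rot ε p q f₁ = F1
    generalize rot ε p q f₀ = F0
    have e1 : (C ((N * t ^ 3)⁻¹) * (C N * C t ^ 3) : MvPolynomial (Fin 3) K) = 1 := by
      rw [← C_pow, ← C_mul, ← C_mul, inv_mul_cancel₀ (by positivity), C_1]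
    have e2 : (C ((N * t)⁻¹) : MvPolynomial (Fin 3) K) = C ((N * t ^ 3)⁻¹) * C t ^ 2 := by
      rw [← C_pow, ← C_mul]
      congr 1
      field_simp
    have e3 : (C ((N * t ^ 2)⁻¹) : MvPolynomial (Fin 3) K) = C ((N * t ^ 3)⁻¹) * C t := by
      rw [← C_mul]
      congr 1
      field_simp
    have eN : (C N : MvPolynomial (Fin 3) K) = C p ^ 2 - C ε * C q ^ 2 := by
      simp [hNdef]
    rw [e2, e3]
    rw [eN] at e1 ⊢
    simp only [algebraMap_eq, map_mul]
    generalize (C ((N * t ^ 3)⁻¹) : MvPolynomial (Fin 3) K) = L at *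
    generalize (C p : MvPolynomial (Fin 3) K) = P at *
    generalize (C q : MvPolynomial (Fin 3) K) = Q at *
    generalize (C ε : MvPolynomial (Fin 3) K) = E at *
    generalize (C t : MvPolynomial (Fin 3) K) = T at *
    linear_combination ((X 0 ^ 2 - E * X 1 ^ 2) * X 2 ^ 3) * e1
      + (L * (P^2 - E*Q^2) * (X 0 ^ 2 - E * X 1 ^ 2) * (l ^ 2 * T * X 2 + l * T ^ 2 * X 2 ^ 2)
        + L * T * l * F2 * X 2) * h3

theorem norm_ne_zero_of {K : Type*} [Field K] {ε : K}
    (hεns : ¬ ∃ t : K, t ^ 2 = ε) {p q : K} (h : p ≠ 0 ∨ q ≠ 0) : p ^ 2 - ε * q ^ 2 ≠ 0 := by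
  intro h0
  by_cases hq : q = 0
  · subst hq
    simp at h0
    simp [h0] at h
  · exact hεns ⟨p / q, by field_simp; linear_combination h0⟩

theorem exists_cube_root {K : Type*} [Field K] [Fintype K] [CharP K 3] (a : K) :
    ∃ b : K, b ^ 3 = a := by
  have : Fact (Nat.Prime 3) := ⟨Nat.prime_three⟩
  obtain ⟨b, hb⟩ := surjective_frobenius K 3 a
  exact ⟨b, by simpa [frobenius_def] using hb⟩

theorem rot_lin {K : Type*} [Field K] (ε p q : K) :
    rot ε p q (X 0) = C p * X 0 + C (ε * q) * X 1 ∧ rot ε p q (X 1) = C q * X 0 + C p * X 1 := by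
  constructor <;> simp [rot]

theorem exists_rot {K : Type*} [Field K] [Fintype K] [CharP K 3]
    (ε : K) (hε0 : ε ≠ 0) (hεns : ¬ ∃ t : K, t ^ 2 = ε)
    {f : MvPolynomial (Fin 3) K} (h : BinForm 3 f) :
    ∃ p q m n₀ n₁ : K, p ^ 2 - ε * q ^ 2 ≠ 0 ∧
      rot ε p q f = C m * (X 0 * (X 0 ^ 2 - C ε * X 1 ^ 2)) + C n₀ * X 0 ^ 3 + C n₁ * X 1 ^ 3 ∧
      (m = 0 → n₁ = 0) := by
  have h3 : (3 : MvPolynomial (Fin 3) K) = 0 := by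
    have := CharP.cast_eq_zero (MvPolynomial (Fin 3) K) 3
    exact_mod_cast this
  obtain ⟨m₀, m₁, n₀, n₁, rfl⟩ : ∃ m₀ m₁ n₀ n₁ : K,
      f = (C m₀ * X 0 + C m₁ * X 1) * (X 0 ^ 2 - C ε * X 1 ^ 2)
        + C n₀ * X 0 ^ 3 + C n₁ * X 1 ^ 3 := by
    obtain ⟨c, rfl⟩ := h.exists_coeff
    refine ⟨-c 2 / ε, c 1, c 0 + c 2 / ε, c 3 + ε * c 1, ?_⟩
    have e : (C (c 2) : MvPolynomial (Fin 3) K) = C ε * C (c 2 / ε) := by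
      rw [← C_mul]
      congr 1
      field_simp
    simp only [Finset.sum_range_succ, Finset.range_zero, Finset.sum_empty, neg_div, C_neg,
      C_add, C_mul, e]
    ring
  have hr := rot_lin (K := K) ε
  have hC : ∀ p q a : K, rot ε p q (C a) = C a := fun p q a => by simp [rot]
  have hQ : ∀ p q : K, rot ε p q (X 0 ^ 2 - C ε * X 1 ^ 2) =
      C (p ^ 2 - ε * q ^ 2) * (X 0 ^ 2 - C ε * X 1 ^ 2) := by
    intro p q
    simp only [map_sub, map_mul, map_pow, (hr p q).1, (hr p q).2, hC]
    ring
  have hX0 : ∀ p q : K, rot ε p q (X 0 ^ 3) = C (p ^ 3) * X 0 ^ 3 + C (ε ^ 3 * q ^ 3) * X 1 ^ 3 := by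
    intro p q
    simp only [map_mul, map_pow, (hr p q).1]
    linear_combination (C p ^ 2 * X 0 ^ 2 * (C ε * C q * X 1)
      + C p * X 0 * (C ε * C q * X 1) ^ 2) * h3
  have hX1 : ∀ p q : K, rot ε p q (X 1 ^ 3) = C (q ^ 3) * X 0 ^ 3 + C (p ^ 3) * X 1 ^ 3 := by
    intro p q
    simp only [map_mul, map_pow, (hr p q).2]
    linear_combination (C q ^ 2 * X 0 ^ 2 * (C p * X 1)
      + C q * X 0 * (C p * X 1) ^ 2) * h3
  have key : ∀ p q : K, rot ε p q ((C m₀ * X 0 + C m₁ * X 1) * (X 0 ^ 2 - C ε * X 1 ^ 2)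
        + C n₀ * X 0 ^ 3 + C n₁ * X 1 ^ 3) =
      (C (m₀ * p + m₁ * q) * X 0 + C (m₀ * (ε * q) + m₁ * p) * X 1)
        * (C (p ^ 2 - ε * q ^ 2) * (X 0 ^ 2 - C ε * X 1 ^ 2))
      + C (n₀ * p ^ 3 + n₁ * q ^ 3) * X 0 ^ 3
      + C (n₀ * (ε ^ 3 * q ^ 3) + n₁ * p ^ 3) * X 1 ^ 3 := by
    intro p q
    rw [map_add, map_add, map_mul, hQ, map_mul, map_mul, hX0, hX1, map_add, map_mul, map_mul,
      (hr p q).1, (hr p q).2, hC, hC, hC, hC]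
    simp only [C_add, C_mul]
    ring
  by_cases hm : m₀ ≠ 0 ∨ m₁ ≠ 0
  · have hN : m₀ ^ 2 - ε * (-m₁ / ε) ^ 2 ≠ 0 := by
      apply norm_ne_zero_of hεns
      rcases hm with hm | hm
      · exact Or.inl hm
      · exact Or.inr (div_ne_zero (neg_ne_zero.mpr hm) hε0)
    have e0 : m₀ * m₀ + m₁ * (-m₁ / ε) = m₀ ^ 2 - ε * (-m₁ / ε) ^ 2 := by
      field_simp
      ring
    have e1 : m₀ * (ε * (-m₁ / ε)) + m₁ * m₀ = 0 := by
      field_simp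
      ring
    refine ⟨m₀, -m₁ / ε, (m₀ ^ 2 - ε * (-m₁ / ε) ^ 2) ^ 2,
      n₀ * m₀ ^ 3 + n₁ * (-m₁ / ε) ^ 3, n₀ * (ε ^ 3 * (-m₁ / ε) ^ 3) + n₁ * m₀ ^ 3, hN, ?_, ?_⟩
    · rw [key, e0, e1]
      simp only [C_0, C_pow]
      ring
    · intro hh
      exact absurd hh (pow_ne_zero 2 hN)
  · push Not at hm
    obtain ⟨rfl, rfl⟩ := hm
    obtain ⟨u, rfl⟩ := exists_cube_root n₀
    obtain ⟨v, rfl⟩ := exists_cube_root n₁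
    by_cases huv : u ≠ 0 ∨ v ≠ 0
    · have hN : u ^ 2 - ε * (-v / ε) ^ 2 ≠ 0 := by
        apply norm_ne_zero_of hεns
        rcases huv with hm | hm
        · exact Or.inl hm
        · exact Or.inr (div_ne_zero (neg_ne_zero.mpr hm) hε0)
      refine ⟨u, -v / ε, 0, u ^ 3 * u ^ 3 + v ^ 3 * (-v / ε) ^ 3, 0, hN, ?_, fun _ => rfl⟩
      have e1 : u ^ 3 * (ε ^ 3 * (-v / ε) ^ 3) + v ^ 3 * u ^ 3 = 0 := by
        field_simp
        ring
      rw [key, e1]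
      simp
    · push Not at huv
      obtain ⟨rfl, rfl⟩ := huv
      exact ⟨1, 0, 0, 0, 0, by simp, by simp, fun _ => rfl⟩

/-- Reduction of plane quintic models of genus-five trigonal curves with a non-split
node, over a finite field `K` of characteristic 3 with `ε` a non-square in `K^×`. -/
theorem trigonal_reduction_nonsplit_node
    {K : Type*} [Field K] [Fintype K] [CharP K 3]
    (ε : K) (hε0 : ε ≠ 0) (hεns : ¬ ∃ t : K, t ^ 2 = ε)
    (f₂ f₁ f₀ : MvPolynomial (Fin 3) K)
    (h₂ : f₂.IsHomogeneous 3) (h₁ : f₁.IsHomogeneous 4) (h₀ : f₀.IsHomogeneous 5)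
    (hv₂ : (2 : Fin 3) ∉ f₂.vars) (hv₁ : (2 : Fin 3) ∉ f₁.vars) (hv₀ : (2 : Fin 3) ∉ f₀.vars)
    (F : MvPolynomial (Fin 3) K)
    (hF : F = (X 0 ^ 2 - C ε * X 1 ^ 2) * X 2 ^ 3 + f₂ * X 2 ^ 2 + f₁ * X 2 + f₀) :
    ∃ (M : GL (Fin 3) K) (lam : K), lam ≠ 0 ∧
      ((∃ a : Fin 12 → K,
        C lam * changeVars (M : Matrix (Fin 3) (Fin 3) K) F =
          (X 0 ^ 2 - C ε * X 1 ^ 2) * X 2 ^ 3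
          + (C (a 1) * (X 0 * (X 0 ^ 2 - C ε * X 1 ^ 2)) + C (a 2) * X 0 ^ 3 + X 1 ^ 3) * X 2 ^ 2
          + (C (a 3) * X 0 ^ 4 + C (a 4) * X 0 ^ 3 * X 1 + C (a 5) * X 0 ^ 2 * X 1 ^ 2) * X 2
          + C (a 6) * X 0 ^ 5 + C (a 7) * X 0 ^ 4 * X 1 + C (a 8) * X 0 ^ 3 * X 1 ^ 2
          + C (a 9) * X 0 ^ 2 * X 1 ^ 3 + C (a 10) * X 0 * X 1 ^ 4 + C (a 11) * X 1 ^ 5)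
      ∨ (∃ a : Fin 11 → K,
        C lam * changeVars (M : Matrix (Fin 3) (Fin 3) K) F =
          (X 0 ^ 2 - C ε * X 1 ^ 2) * X 2 ^ 3
          + (X 0 * (X 0 ^ 2 - C ε * X 1 ^ 2) + C (a 1) * X 0 ^ 3) * X 2 ^ 2
          + (C (a 2) * X 0 ^ 4 + C (a 3) * X 0 ^ 3 * X 1 + C (a 4) * X 1 ^ 4) * X 2
          + C (a 5) * X 0 ^ 5 + C (a 6) * X 0 ^ 4 * X 1 + C (a 7) * X 0 ^ 3 * X 1 ^ 2
          + C (a 8) * X 0 ^ 2 * X 1 ^ 3 + C (a 9) * X 0 * X 1 ^ 4 + C (a 10) * X 1 ^ 5)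
      ∨ (∃ a : Fin 10 → K,
        C lam * changeVars (M : Matrix (Fin 3) (Fin 3) K) F =
          (X 0 ^ 2 - C ε * X 1 ^ 2) * X 2 ^ 3 + X 0 ^ 3 * X 2 ^ 2
          + (C (a 1) * X 0 ^ 2 * X 1 ^ 2 + C (a 2) * X 0 * X 1 ^ 3 + C (a 3) * X 1 ^ 4) * X 2
          + C (a 4) * X 0 ^ 5 + C (a 5) * X 0 ^ 4 * X 1 + C (a 6) * X 0 ^ 3 * X 1 ^ 2
          + C (a 7) * X 0 ^ 2 * X 1 ^ 3 + C (a 8) * X 0 * X 1 ^ 4 + C (a 9) * X 1 ^ 5)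
      ∨ (∃ (a : Fin 6 → K) (b : Fin 6 → K),
        C lam * changeVars (M : Matrix (Fin 3) (Fin 3) K) F =
          (X 0 ^ 2 - C ε * X 1 ^ 2) * X 2 ^ 3
          + (C (a 1) * X 0 ^ 4 + C (a 2) * X 0 ^ 3 * X 1 + C (a 3) * X 0 ^ 2 * X 1 ^ 2
              + C (a 4) * X 0 * X 1 ^ 3 + C (a 5) * X 1 ^ 4) * X 2
          + C (b 0) * X 0 ^ 5 + C (b 1) * X 0 ^ 4 * X 1 + C (b 2) * X 0 ^ 3 * X 1 ^ 2
          + C (b 3) * X 0 ^ 2 * X 1 ^ 3 + C (b 4) * X 0 * X 1 ^ 4 + C (b 5) * X 1 ^ 5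
        ∧ ((∀ i : Fin 6, b i = 0) ∨
            ∃ i : Fin 6, (∀ j : Fin 6, j < i → b j = 0) ∧ b i = 1))) := by
  have b₂ := binForm_of h₂ hv₂
  have b₁ := binForm_of h₁ hv₁
  have b₀ := binForm_of h₀ hv₀
  subst hF
  obtain ⟨p, q, m, n₀, n₁, hN, hrot, hmn⟩ := exists_rot ε hε0 hεns b₂
  obtain ⟨d, hd⟩ := (b₁.rot ε p q).exists_coeff
  have hC : ∀ a b : K, a = b → (C a : MvPolynomial (Fin 3) K) = C b := fun a b h => by rw [h]
  by_cases hn₁ : n₁ = 0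
  · by_cases hm : m = 0
    · by_cases hn₀ : n₀ = 0
      · -- case (4)
        subst hn₁ hm hn₀
        obtain ⟨e, he⟩ := (b₀.rot ε p q).exists_coeff
        obtain ⟨t, ht, hbt⟩ : ∃ t : K, t ≠ 0 ∧
            ((∀ i : Fin 6, ((p ^ 2 - ε * q ^ 2) * t ^ 3)⁻¹ * e i = 0) ∨
            ∃ i : Fin 6, (∀ j : Fin 6, j < i → ((p ^ 2 - ε * q ^ 2) * t ^ 3)⁻¹ * e j = 0) ∧
              ((p ^ 2 - ε * q ^ 2) * t ^ 3)⁻¹ * e i = 1) := by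
          by_cases hall : ∀ i : Fin 6, e i = 0
          · exact ⟨1, one_ne_zero, Or.inl fun i => by rw [hall i, mul_zero]⟩
          · push Not at hall
            have hex : ∃ i : ℕ, e i ≠ 0 ∧ i < 6 := by
              obtain ⟨i, hi⟩ := hall
              exact ⟨i, hi, i.2⟩
            classical
            obtain ⟨hi, hi6⟩ := Nat.find_spec hex
            have hmin : ∀ j < Nat.find hex, e j = 0 := by
              intro j hj
              by_contra hne
              exact Nat.find_min hex hj ⟨hne, by omega⟩
            generalize Nat.find hex = i at *
            obtain ⟨t, ht⟩ := exists_cube_root (e i / (p ^ 2 - ε * q ^ 2))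
            have ht0 : t ≠ 0 := by
              rintro rfl
              have : e i / (p ^ 2 - ε * q ^ 2) ≠ 0 := div_ne_zero hi hN
              exact this (by rw [← ht]; simp)
            refine ⟨t, ht0, Or.inr ⟨⟨i, hi6⟩, fun j hj => ?_, ?_⟩⟩
            · rw [hmin j (by simpa [Fin.lt_def] using hj), mul_zero]
            · rw [ht, mul_div_cancel₀ _ hN]
              exact inv_mul_cancel₀ hi
        obtain ⟨M, lam, hlam, g, hg, hg0, hM⟩ :=
          subst_form ε p q 0 0 t hN ht b₂ b₁ b₀
        refine ⟨M, lam, hlam, Or.inr (Or.inr (Or.inr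
          ⟨fun i => ((p ^ 2 - ε * q ^ 2) * t ^ 2)⁻¹ * d (i - 1 : ℕ),
           fun i => ((p ^ 2 - ε * q ^ 2) * t ^ 3)⁻¹ * e i, ?_, hbt⟩))⟩
        rw [hM, hg0 rfl rfl, hrot, hd, he]
        generalize ((p ^ 2 - ε * q ^ 2) * t ^ 3)⁻¹ = A
        generalize ((p ^ 2 - ε * q ^ 2) * t ^ 2)⁻¹ = B
        simp [Finset.sum_range_succ]
        ring
      · -- case (3)
        subst hn₁ hm
        obtain ⟨M, lam, hlam, g, hg, -, hM⟩ :=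
          subst_form ε p q (d 0 / n₀) (d 1 / n₀) (n₀ / (p ^ 2 - ε * q ^ 2)) hN
            (div_ne_zero hn₀ hN) b₂ b₁ b₀
        obtain ⟨e, he⟩ := hg.exists_coeff
        generalize ((p ^ 2 - ε * q ^ 2) * (n₀ / (p ^ 2 - ε * q ^ 2)) ^ 2)⁻¹ = B at hM
        refine ⟨M, lam, hlam, Or.inr (Or.inr (Or.inl
          ⟨![0, B * d 2, B * d 3, B * d 4, e 0, e 1, e 2, e 3, e 4, e 5], ?_⟩))⟩
        rw [hM, hrot, hd, he, mul_div_cancel₀ _ hN]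
        have k1 := hC (n₀⁻¹ * n₀) 1 (by field_simp)
        have k2 := hC (d 0 / n₀ * n₀) (d 0) (by field_simp)
        have k3 := hC (d 1 / n₀ * n₀) (d 1) (by field_simp)
        simp only [C_mul, C_1] at k1 k2 k3
        simp [Finset.sum_range_succ]
        linear_combination (X 0 ^ 3 * X 2 ^ 2) * k1 - (C B * X 0 ^ 4 * X 2) * k2
          - (C B * X 0 ^ 3 * X 1 * X 2) * k3
    · -- case (2)
      subst hn₁
      obtain ⟨M, lam, hlam, g, hg, -, hM⟩ :=
        subst_form ε p q (-d 2 / (ε * m)) (-d 3 / (ε * m)) (m / (p ^ 2 - ε * q ^ 2)) hN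
          (div_ne_zero hm hN) b₂ b₁ b₀
      obtain ⟨e, he⟩ := hg.exists_coeff
      generalize ((p ^ 2 - ε * q ^ 2) * (m / (p ^ 2 - ε * q ^ 2)) ^ 2)⁻¹ = B at hM
      have k1 := hC (m⁻¹ * m) 1 (by field_simp)
      have k2 := hC (-d 2 / (ε * m) * m * ε) (-d 2) (by field_simp)
      have k3 := hC (-d 3 / (ε * m) * m * ε) (-d 3) (by field_simp)
      generalize -d 2 / (ε * m) = r at *
      generalize -d 3 / (ε * m) = s at *
      refine ⟨M, lam, hlam, Or.inr (Or.inl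
        ⟨![0, m⁻¹ * n₀, B * (d 0 - r * (m + n₀)), B * (d 1 - s * (m + n₀)), B * d 4,
          e 0, e 1, e 2, e 3, e 4, e 5], ?_⟩)⟩
      rw [hM, hrot, hd, he, mul_div_cancel₀ _ hN]
      simp only [C_mul, C_1, C_neg] at k1 k2 k3
      simp [Finset.sum_range_succ]
      linear_combination (X 0 * (X 0 ^ 2 - C ε * X 1 ^ 2) * X 2 ^ 2) * k1
        + (C B * X 0 ^ 2 * X 1 ^ 2 * X 2) * k2 + (C B * X 0 * X 1 ^ 3 * X 2) * k3
  · -- case (1)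
    obtain ⟨M, lam, hlam, g, hg, -, hM⟩ :=
      subst_form ε p q ((d 3 + d 4 / n₁ * ε * m) / n₁) (d 4 / n₁) (n₁ / (p ^ 2 - ε * q ^ 2)) hN
        (div_ne_zero hn₁ hN) b₂ b₁ b₀
    obtain ⟨e, he⟩ := hg.exists_coeff
    generalize ((p ^ 2 - ε * q ^ 2) * (n₁ / (p ^ 2 - ε * q ^ 2)) ^ 2)⁻¹ = B at hM
    have k1 := hC (n₁⁻¹ * n₁) 1 (by field_simp)
    have k2 := hC ((d 3 + d 4 / n₁ * ε * m) / n₁ * n₁) (d 3 + d 4 / n₁ * ε * m) (by field_simp)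
    have k3 := hC (d 4 / n₁ * n₁) (d 4) (by field_simp)
    generalize (d 3 + d 4 / n₁ * ε * m) / n₁ = r at *
    generalize d 4 / n₁ = s at *
    refine ⟨M, lam, hlam, Or.inl
      ⟨![0, n₁⁻¹ * m, n₁⁻¹ * n₀, B * (d 0 - r * (m + n₀)), B * (d 1 - s * (m + n₀)),
        B * (d 2 + r * ε * m), e 0, e 1, e 2, e 3, e 4, e 5], ?_⟩⟩
    rw [hM, hrot, hd, he, mul_div_cancel₀ _ hN]
    simp only [C_mul, C_1, C_add] at k1 k2 k3
    simp [Finset.sum_range_succ]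
    linear_combination (X 1 ^ 3 * X 2 ^ 2) * k1
      - (C B * X 0 * X 1 ^ 3 * X 2) * k2 - (C B * X 1 ^ 4 * X 2) * k3
end

section
/- Let K be a finite field of characteristic 3. Let F = x² z³ + f₂ z² + f₁ z + f₀ ∈ K[x,y,z], where f₂, f₁, f₀ ∈ K[x,y] are homogeneous of degrees 3, 4, 5 respectively, and assume that the coefficient of y³ in f₂ is nonzero. Then there exist M ∈ GL₃(K) and a nonzero λ ∈ K such that λ·(F∘M) = x²z³ + (b₁x³ + b₂x²y + a₁xy² + a₂y³)z² + (a₃x⁴ + a₄x³y + a₅x²y²)z + a₆x⁵ + a₇x⁴y + a₈x³y² + a₉x²y³ + a₁₀xy⁴ + a₁₁y⁵ for some a₁, …, a₁₁ ∈ K with a₂ ≠ 0 and b₁, b₂ ∈ {0, 1}. -/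
open MvPolynomial

set_option maxHeartbeats 1000000

lemma binary_form_expand {K : Type*} [Field K] (n : ℕ) (f : MvPolynomial (Fin 3) K)
    (h : f.IsHomogeneous n) (hv : (2 : Fin 3) ∉ f.vars) :
    ∃ c : ℕ → K, f.coeff (Finsupp.single 1 n) = c n ∧
      f = ∑ i ∈ Finset.range (n + 1), C (c i) * X 0 ^ (n - i) * X 1 ^ i := by
  classical
  let e : ℕ → (Fin 3 →₀ ℕ) := fun i => Finsupp.single 0 (n - i) + Finsupp.single 1 i
  refine ⟨fun i => f.coeff (e i), by simp [e], ?_⟩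
  have hinj : Set.InjOn e (Finset.range (n + 1)) := by
    intro i _ j _ hij
    have := DFunLike.congr_fun hij 1
    simpa [e] using this
  have hsub : f.support ⊆ (Finset.range (n + 1)).image e := by
    intro m hm
    have hd := h (mem_support_iff.1 hm)
    have hm2 : m 2 = 0 := by
      by_contra h2
      exact hv ((mem_vars_iff_mem_support 2).2 ⟨m, hm, Finsupp.mem_support_iff.2 h2⟩)
    have hd' : m 0 + m 1 + m 2 = n := by
      rw [← hd, Finsupp.weight_apply, Finsupp.sum_fintype _ _ (by simp)]
      simp [Fin.sum_univ_three]
    refine Finset.mem_image.2 ⟨m 1, Finset.mem_range.2 (by omega), ?_⟩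
    ext k
    fin_cases k
    · simp [e]; omega
    · simp [e]
    · simp [e, hm2]
  conv_lhs => rw [f.as_sum]
  rw [Finset.sum_subset hsub, Finset.sum_image hinj]
  · refine Finset.sum_congr rfl fun i _ => ?_
    rw [mul_assoc, X_pow_eq_monomial, X_pow_eq_monomial, monomial_mul, C_mul_monomial]
    simp [e]
  · intro m _ hm
    rw [notMem_support_iff.1 hm, monomial_zero]

/-- Reduction of plane quintic models of genus-five trigonal curves with a cusp,
over a finite field `K` of characteristic 3. -/
theorem trigonal_reduction_cusp
    {K : Type*} [Field K] [Fintype K] [CharP K 3]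
    (f₂ f₁ f₀ : MvPolynomial (Fin 3) K)
    (h₂ : f₂.IsHomogeneous 3) (h₁ : f₁.IsHomogeneous 4) (h₀ : f₀.IsHomogeneous 5)
    (hv₂ : (2 : Fin 3) ∉ f₂.vars) (hv₁ : (2 : Fin 3) ∉ f₁.vars) (hv₀ : (2 : Fin 3) ∉ f₀.vars)
    (hy3 : f₂.coeff (Finsupp.single 1 3) ≠ 0)
    (F : MvPolynomial (Fin 3) K)
    (hF : F = X 0 ^ 2 * X 2 ^ 3 + f₂ * X 2 ^ 2 + f₁ * X 2 + f₀) :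
    ∃ (M : GL (Fin 3) K) (lam : K) (b₁ b₂ : K) (a : Fin 12 → K), lam ≠ 0 ∧
      (b₁ = 0 ∨ b₁ = 1) ∧ (b₂ = 0 ∨ b₂ = 1) ∧ a 2 ≠ 0 ∧
      C lam * changeVars (M : Matrix (Fin 3) (Fin 3) K) F =
        X 0 ^ 2 * X 2 ^ 3
        + (C b₁ * X 0 ^ 3 + C b₂ * X 0 ^ 2 * X 1 + C (a 1) * X 0 * X 1 ^ 2
            + C (a 2) * X 1 ^ 3) * X 2 ^ 2
        + (C (a 3) * X 0 ^ 4 + C (a 4) * X 0 ^ 3 * X 1 + C (a 5) * X 0 ^ 2 * X 1 ^ 2) * X 2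
        + C (a 6) * X 0 ^ 5 + C (a 7) * X 0 ^ 4 * X 1 + C (a 8) * X 0 ^ 3 * X 1 ^ 2
        + C (a 9) * X 0 ^ 2 * X 1 ^ 3 + C (a 10) * X 0 * X 1 ^ 4 + C (a 11) * X 1 ^ 5 := by
  obtain ⟨p, hp, hf₂⟩ := binary_form_expand 3 f₂ h₂ hv₂
  obtain ⟨q, -, hf₁⟩ := binary_form_expand 4 f₁ h₁ hv₁
  obtain ⟨r, -, hf₀⟩ := binary_form_expand 5 f₀ h₀ hv₀
  rw [hp] at hy3
  have key : ∀ u : K, ∃ v : K, v ≠ 0 ∧ (u * v = 0 ∨ u * v = 1) := by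
    intro u
    by_cases hu : u = 0
    · exact ⟨1, one_ne_zero, Or.inl (by simp [hu])⟩
    · exact ⟨u⁻¹, inv_ne_zero hu, Or.inr (mul_inv_cancel₀ hu)⟩
  obtain ⟨α, hα, hb1⟩ := key (p 0)
  obtain ⟨β, hβ, hb2⟩ := key (p 1)
  have h3 : (3 : K) = 0 := by exact_mod_cast CharP.cast_eq_zero K 3
  obtain ⟨lam, hl0, hl⟩ : ∃ lam : K, lam ≠ 0 ∧ lam * α ^ 2 = 1 :=
    ⟨(α ^ 2)⁻¹, inv_ne_zero (pow_ne_zero 2 hα), inv_mul_cancel₀ (pow_ne_zero 2 hα)⟩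
  obtain ⟨t, ht⟩ : ∃ t : K, q 4 * β ^ 4 + 2 * (p 3 * β ^ 3) * t = 0 := by
    refine ⟨q 4 * β / p 3, ?_⟩
    field_simp
    linear_combination q 4 * β ^ 4 * h3
  obtain ⟨s, hs⟩ : ∃ s : K, q 3 * α * β ^ 3
      + 2 * (p 3 * β ^ 3 * s + p 2 * α * β ^ 2 * t) = 0 := by
    refine ⟨(q 3 * α * β ^ 3 + 2 * (p 2 * α * β ^ 2 * t)) / (p 3 * β ^ 3), ?_⟩
    rw [mul_add, mul_div_cancel₀ _ (mul_ne_zero hy3 (pow_ne_zero 3 hβ))]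
    linear_combination (q 3 * α * β ^ 3 + 2 * (p 2 * α * β ^ 2 * t)) * h3
  let N : Matrix (Fin 3) (Fin 3) K := !![α, 0, 0; 0, β, 0; s, t, 1]
  have hN : N.det ≠ 0 := by
    simp [N, Matrix.det_fin_three, hα, hβ]
  refine ⟨Matrix.GeneralLinearGroup.mkOfDetNeZero N hN, lam, p 0 * α, p 1 * β,
    ![0, lam * (p 2 * α * β ^ 2), lam * (p 3 * β ^ 3),
      lam * (q 0 * α ^ 4 + 2 * (p 0 * α ^ 3) * s),
      lam * (q 1 * α ^ 3 * β + 2 * (p 1 * α ^ 2 * β) * s + 2 * (p 0 * α ^ 3) * t),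
      lam * (q 2 * α ^ 2 * β ^ 2 + 2 * (p 2 * α * β ^ 2) * s + 2 * (p 1 * α ^ 2 * β) * t),
      s ^ 3 + lam * (p 0 * α ^ 3 * s ^ 2 + q 0 * α ^ 4 * s + r 0 * α ^ 5),
      lam * (p 1 * α ^ 2 * β * s ^ 2 + 2 * (p 0 * α ^ 3) * s * t + q 1 * α ^ 3 * β * s
        + q 0 * α ^ 4 * t + r 1 * α ^ 4 * β),
      lam * (p 2 * α * β ^ 2 * s ^ 2 + 2 * (p 1 * α ^ 2 * β) * s * t + p 0 * α ^ 3 * t ^ 2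
        + q 2 * α ^ 2 * β ^ 2 * s + q 1 * α ^ 3 * β * t + r 2 * α ^ 3 * β ^ 2),
      t ^ 3 + lam * (p 3 * β ^ 3 * s ^ 2 + 2 * (p 2 * α * β ^ 2) * s * t
        + p 1 * α ^ 2 * β * t ^ 2 + q 3 * α * β ^ 3 * s + q 2 * α ^ 2 * β ^ 2 * t
        + r 3 * α ^ 2 * β ^ 3),
      lam * (2 * (p 3 * β ^ 3) * s * t + p 2 * α * β ^ 2 * t ^ 2 + q 4 * β ^ 4 * s
        + q 3 * α * β ^ 3 * t + r 4 * α * β ^ 4),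
      lam * (p 3 * β ^ 3 * t ^ 2 + q 4 * β ^ 4 * t + r 5 * β ^ 5)],
    hl0, hb1, hb2, ?_, ?_⟩
  · exact mul_ne_zero hl0 (mul_ne_zero hy3 (pow_ne_zero 3 hβ))
  have h3' := congrArg (C : K → MvPolynomial (Fin 3) K) h3
  have hl' := congrArg (C : K → MvPolynomial (Fin 3) K) hl
  have ht' := congrArg (C : K → MvPolynomial (Fin 3) K) ht
  have hs' := congrArg (C : K → MvPolynomial (Fin 3) K) hs
  have hM : ((Matrix.GeneralLinearGroup.mkOfDetNeZero N hN : GL (Fin 3) K) :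
    Matrix (Fin 3) (Fin 3) K) = N := rfl
  have hch : changeVars N F = C α ^ 2 * X 0 ^ 2 * (C s * X 0 + C t * X 1 + X 2) ^ 3
      + (C (p 0) * (C α * X 0) ^ 3 + C (p 1) * (C α * X 0) ^ 2 * (C β * X 1)
        + C (p 2) * (C α * X 0) * (C β * X 1) ^ 2 + C (p 3) * (C β * X 1) ^ 3)
        * (C s * X 0 + C t * X 1 + X 2) ^ 2
      + (C (q 0) * (C α * X 0) ^ 4 + C (q 1) * (C α * X 0) ^ 3 * (C β * X 1)
        + C (q 2) * (C α * X 0) ^ 2 * (C β * X 1) ^ 2 + C (q 3) * (C α * X 0) * (C β * X 1) ^ 3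
        + C (q 4) * (C β * X 1) ^ 4) * (C s * X 0 + C t * X 1 + X 2)
      + (C (r 0) * (C α * X 0) ^ 5 + C (r 1) * (C α * X 0) ^ 4 * (C β * X 1)
        + C (r 2) * (C α * X 0) ^ 3 * (C β * X 1) ^ 2
        + C (r 3) * (C α * X 0) ^ 2 * (C β * X 1) ^ 3
        + C (r 4) * (C α * X 0) * (C β * X 1) ^ 4 + C (r 5) * (C β * X 1) ^ 5) := by
    rw [hF, hf₂, hf₁, hf₀]
    simp [-mul_eq_mul_right_iff, changeVars, N, Finset.sum_range_succ, Fin.sum_univ_three, algebraMap_eq]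
    ring
  have hC2 : (C 2 : MvPolynomial (Fin 3) K) = 2 := map_ofNat C 2
  have hC3 : (C 3 : MvPolynomial (Fin 3) K) = 3 := map_ofNat C 3
  rw [hM, hch]
  simp only [map_add, map_mul, map_pow, map_zero, map_one, hC2, hC3] at h3' hl' ht' hs'
  simp only [Matrix.cons_val, map_add, map_mul, map_pow, hC2]
  linear_combination (X 0 ^ 2 * (C s * X 0 + C t * X 1 + X 2) ^ 3
      + C (p 0) * C α * X 0 ^ 3 * X 2 ^ 2 + C (p 1) * C β * X 0 ^ 2 * X 1 * X 2 ^ 2) * hl'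
    + C lam * X 1 ^ 4 * X 2 * ht' + C lam * X 0 * X 1 ^ 3 * X 2 * hs'
    + X 0 ^ 2 * (X 2 ^ 2 * (C s * X 0 + C t * X 1) + X 2 * (C s * X 0 + C t * X 1) ^ 2
      + (C s * X 0) ^ 2 * (C t * X 1) + (C s * X 0) * (C t * X 1) ^ 2) * h3'
end

section
/- For every monic square-free polynomial f ∈ F_3[x] of degree 12 and every nonzero c ∈ F_3, the number of pairs (x, y) ∈ F_9 × F_9 satisfying c·y² = f(x) (with c and the coefficients of f viewed in F_9) is at most 18. (Since every nonzero element of F_3 is a square in F_9, the corresponding genus-five hyperelliptic curve over F_3 has exactly 2 more F_9-rational points than this affine count; hence every genus-five hyperelliptic curve over F_3 has at most 20 F_9-rational points.) -/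
instance : Fact (Nat.Prime 3) := ⟨by norm_num⟩

/-- Every genus-five hyperelliptic affine model `c y² = f(x)` over `F₃` has at most
`18` affine `F₉`-points. -/
theorem hyperelliptic_genus5_F9_affine_points_le
    (f : Polynomial (ZMod 3)) (hmonic : f.Monic) (hsf : Squarefree f)
    (hdeg : f.natDegree = 12) (c : ZMod 3) (hc : c ≠ 0) :
    Nat.card {p : GaloisField 3 2 × GaloisField 3 2 //
      algebraMap (ZMod 3) (GaloisField 3 2) c * p.2 ^ 2 = Polynomial.aeval p.1 f} ≤ 18 := by
  classical
  letI : Fintype (GaloisField 3 2) := Fintype.ofFinite _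
  have hcard : Fintype.card (GaloisField 3 2) = 9 := by
    rw [← Nat.card_eq_fintype_card, GaloisField.card 3 2 (by norm_num)]; norm_num
  have hc' : algebraMap (ZMod 3) (GaloisField 3 2) c ≠ 0 := by
    simpa using hc
  rw [Nat.card_eq_fintype_card, Fintype.card_subtype]
  -- each of the nine values of `x` admits at most two values of `y`
  have key := Finset.card_le_mul_card_image_of_maps_to
    (s := Finset.univ.filter (fun p : GaloisField 3 2 × GaloisField 3 2 =>
      algebraMap (ZMod 3) (GaloisField 3 2) c * p.2 ^ 2 = Polynomial.aeval p.1 f))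
    (t := Finset.univ) (f := Prod.fst) (fun _ _ => Finset.mem_univ _) 2 (by
      intro x _
      by_contra! h
      obtain ⟨p, hp, q, hq, r, hr, hpq, hpr, hqr⟩ := Finset.two_lt_card.1 h
      simp only [Finset.mem_filter, Finset.mem_univ, true_and] at hp hq hr
      obtain ⟨p1, p2⟩ := p
      obtain ⟨q1, q2⟩ := q
      obtain ⟨r1, r2⟩ := r
      obtain ⟨hp, rfl⟩ := hp
      obtain ⟨hq, rfl⟩ := hq
      obtain ⟨hr, rfl⟩ := hr
      have h1 : p2 ^ 2 = q2 ^ 2 := mul_left_cancel₀ hc' (hp.trans hq.symm)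
      have h2 : p2 ^ 2 = r2 ^ 2 := mul_left_cancel₀ hc' (hp.trans hr.symm)
      rcases sq_eq_sq_iff_eq_or_eq_neg.1 h1 with h1 | h1
      · exact hpq (by rw [h1])
      rcases sq_eq_sq_iff_eq_or_eq_neg.1 h2 with h2 | h2
      · exact hpr (by rw [h2])
      exact hqr (by rw [neg_injective (h1.symm.trans h2)]))
  rw [Finset.card_univ, hcard] at key
  exact key
end

section
/- The polynomial f = x¹² + x¹¹ + 2x⁷ + x⁵ + 2x + 1 ∈ F_3[x] is square-free, and the number of pairs (x, y) ∈ F_9 × F_9 satisfying y² = f(x) (coefficients of f viewed in F_9) is exactly 18. (Hence the genus-five hyperelliptic curve y² = f(x) over F_3 has exactly 20 F_9-rational points, the maximal possible number.) -/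
open Polynomial

theorem ex1_squarefree :
    Squarefree ((X : Polynomial (ZMod 3)) ^ 12 + X ^ 11 + C 2 * X ^ 7 + X ^ 5 + C 2 * X + 1) := by
  apply Polynomial.Separable.squarefree
  have h3 : (3 : Polynomial (ZMod 3)) = 0 := by
    exact_mod_cast CharP.cast_eq_zero (Polynomial (ZMod 3)) 3
  have hC : (C (2 : ZMod 3)) = 2 := by
    rw [show (2 : ZMod 3) = 1 + 1 from by decide, C_add, C_1, one_add_one_eq_two]
  refine ⟨(1)*X^0 + (2)*X^1 + (2)*X^2 + (2)*X^6 + (2)*X^7 + (2)*X^8,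
    (1)*X^1 + (1)*X^3 + (1)*X^6 + (2)*X^7 + (1)*X^8 + (1)*X^9 + (2)*X^10, ?_⟩
  simp only [hC, derivative_add, derivative_mul, derivative_X_pow, derivative_X, derivative_one,
    derivative_ofNat, Nat.cast_ofNat, map_ofNat]
  linear_combination ((2)*X^1 + (2)*X^2 + (2)*X^3 + (2)*X^5 + (2)*X^6 + (11)*X^7 + (4)*X^8 + (8)*X^9 + (3)*X^10 + (8)*X^11 + (12)*X^12 + (18)*X^13 + (14)*X^14 + (6)*X^15 + (13)*X^16 + (12)*X^17 + (13)*X^18 + (9)*X^19 + (12)*X^20 + (8)*X^21) * h3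

theorem ex1_pow_four {K : Type*} [Field K] (h3 : (3 : K) = 0) (x a : K) (h9 : x ^ 9 = x)
    (ha : a = x ^ 12 + x ^ 11 + 2 * x ^ 7 + x ^ 5 + 2 * x + 1) : a ^ 4 = 1 := by
  have ha' : a = (1)*x^0 + (2)*x^1 + (1)*x^3 + (1)*x^4 + (1)*x^5 + (2)*x^7 := by
    rw [ha]
    linear_combination (x ^ 3 + x ^ 2) * h9
  rw [ha']
  linear_combination ((472)*x^0 + (516)*x^1 + (444)*x^2 + (502)*x^3 + (404)*x^4 + (430)*x^5 + (356)*x^6 + (379)*x^7 + (240)*x^8 + (282)*x^9 + (204)*x^10 + (185)*x^11 + (104)*x^12 + (144)*x^13 + (48)*x^14 + (56)*x^15 + (32)*x^16 + (32)*x^17 + (16)*x^19) * h9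
    + ((160)*x^1 + (180)*x^2 + (160)*x^3 + (182)*x^4 + (160)*x^5 + (180)*x^6 + (160)*x^7 + (183)*x^8) * h3

theorem ex1_card_two {K : Type*} [Field K] [Finite K] (h3 : (3 : K) = 0)
    (hK : Nat.card K = 9) (a : K) (ha : a ^ 4 = 1) : Nat.card {y : K // y ^ 2 = a} = 2 := by
  have := Fintype.ofFinite K
  have h2 : (2 : K) ≠ 0 := by
    intro h
    have : (1 : K) = 0 := by linear_combination h3 - h
    exact one_ne_zero this
  have hc : ringChar K ≠ 2 := by
    intro h
    apply h2
    have := ringChar.Nat.cast_ringChar (R := K)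
    rw [h] at this
    exact_mod_cast this
  have ha0 : a ≠ 0 := by
    rintro rfl
    simp at ha
  obtain ⟨s, hs⟩ := (FiniteField.isSquare_iff hc ha0).2 (by
    rw [← Nat.card_eq_fintype_card, hK]; exact ha)
  have hs0 : s ≠ 0 := by
    rintro rfl
    exact ha0 (by simpa using hs)
  have hset : {y : K | y ^ 2 = a} = {s, -s} := by
    ext y
    simp only [Set.mem_ofPred_eq, Set.mem_insert_iff, Set.mem_singleton_iff]
    rw [hs, ← sq, sq_eq_sq_iff_eq_or_eq_neg]
  change Nat.card ({y : K | y ^ 2 = a} : Set K) = 2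
  rw [hset, Nat.card_coe_set_eq, Set.ncard_pair]
  intro h
  have : 2 * s = 0 := by linear_combination h
  exact (mul_ne_zero h2 hs0) this

/-- The genus-five hyperelliptic curve `y² = x¹² + x¹¹ + 2x⁷ + x⁵ + 2x + 1` over `F₃`
has `18` affine `F₉`-points (hence `20` `F₉`-rational points, the maximum). -/
theorem hyperelliptic_example1_F9_affine_points :
    Squarefree ((X : Polynomial (ZMod 3)) ^ 12 + X ^ 11 + C 2 * X ^ 7 + X ^ 5 + C 2 * X + 1) ∧
    Nat.card {p : GaloisField 3 2 × GaloisField 3 2 //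
      p.2 ^ 2 = Polynomial.aeval p.1
        ((X : Polynomial (ZMod 3)) ^ 12 + X ^ 11 + C 2 * X ^ 7 + X ^ 5 + C 2 * X + 1)} = 18 := by
  refine ⟨ex1_squarefree, ?_⟩
  have hK : Nat.card (GaloisField 3 2) = 9 := by
    rw [GaloisField.card 3 2 (by norm_num)]; norm_num
  have : Finite (GaloisField 3 2) := Nat.finite_of_card_ne_zero (by rw [hK]; norm_num)
  have := Fintype.ofFinite (GaloisField 3 2)
  have h3 : (3 : GaloisField 3 2) = 0 := by
    exact_mod_cast CharP.cast_eq_zero (GaloisField 3 2) 3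
  rw [Nat.card_congr (Equiv.subtypeProdEquivSigmaSubtype
    (fun x y : GaloisField 3 2 => y ^ 2 = Polynomial.aeval x
      ((X : Polynomial (ZMod 3)) ^ 12 + X ^ 11 + C 2 * X ^ 7 + X ^ 5 + C 2 * X + 1))),
    Nat.card_sigma]
  rw [Finset.sum_congr rfl (fun x _ => ex1_card_two h3 hK _ (ex1_pow_four h3 x _ ?_ ?_))]
  · rw [Finset.sum_const, Finset.card_univ, ← Nat.card_eq_fintype_card, hK]; rfl
  · have := FiniteField.pow_card x
    rwa [← Nat.card_eq_fintype_card, hK] at this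
  · have h2 : algebraMap (ZMod 3) (GaloisField 3 2) 2 = 2 := by
      rw [show (2 : ZMod 3) = 1 + 1 from by decide, map_add, map_one, one_add_one_eq_two]
    simp [h2]
end

section
/- The polynomial f = x¹² + x¹¹ + 2x⁴ + 2x³ + 2 ∈ F_3[x] is square-free, and the number of pairs (x, y) ∈ F_9 × F_9 satisfying y² = f(x) (coefficients of f viewed in F_9) is exactly 18. (Hence the genus-five hyperelliptic curve y² = f(x) over F_3 has exactly 20 F_9-rational points, the maximal possible number.) -/
open Polynomial

lemma fsq_aux : Squarefree ((X : Polynomial (ZMod 3)) ^ 12 + X ^ 11 + C 2 * X ^ 4 + C 2 * X ^ 3 + C 2) := by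
  apply Polynomial.Separable.squarefree
  have h3 : (3 : Polynomial (ZMod 3)) = 0 := by
    have : (3 : ZMod 3) = 0 := by decide
    rw [← map_ofNat (C : ZMod 3 →+* _) 3, this, map_zero]
  refine ⟨2*X^0 + 2*X^6 + 1*X^7 + 1*X^9, 1*X^0 + 1*X^1 + 1*X^3 + 2*X^4 + 2*X^7 + 1*X^9 + 1*X^10 + 1*X^11, ?_⟩
  simp only [derivative_add, derivative_mul, derivative_C, derivative_X_pow, map_ofNat, map_natCast]
  have h2 : derivative (2 : Polynomial (ZMod 3)) = 0 := by
    exact derivative_ofNat 2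
  simp only [h2]
  push_cast
  linear_combination (1*X^0 + 2*X^2 + 6*X^3 + 4*X^4 + 2*X^5 + 8*X^6 + 6*X^7 + 6*X^9 + 11*X^10 + 11*X^11 + 10*X^12 + 9*X^13 + 14*X^14 + 8*X^15 + 8*X^17 + 9*X^18 + 4*X^19 + 8*X^20 + 8*X^21 + 4*X^22) * h3

theorem hyperelliptic_example2_F9_affine_points :
    Squarefree ((X : Polynomial (ZMod 3)) ^ 12 + X ^ 11 + C 2 * X ^ 4 + C 2 * X ^ 3 + C 2) ∧
    Nat.card {p : GaloisField 3 2 × GaloisField 3 2 //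
      p.2 ^ 2 = Polynomial.aeval p.1
        ((X : Polynomial (ZMod 3)) ^ 12 + X ^ 11 + C 2 * X ^ 4 + C 2 * X ^ 3 + C 2)} = 18 := by
  refine ⟨fsq_aux, ?_⟩
  have hcard : Nat.card (GaloisField 3 2) = 9 := by
    rw [GaloisField.card 3 2 (by norm_num)]; norm_num
  haveI : Fintype (GaloisField 3 2) := Fintype.ofFinite _
  have hF : Fintype.card (GaloisField 3 2) = 9 := by rw [← Nat.card_eq_fintype_card, hcard]
  have h3 : (3 : GaloisField 3 2) = 0 := by
    exact_mod_cast CharP.cast_eq_zero (GaloisField 3 2) 3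
  have hpow : ∀ x : GaloisField 3 2, x ^ 9 = x := fun x => by
    rw [← hF]; exact FiniteField.pow_card x
  obtain ⟨i, hi⟩ : IsSquare (-1 : GaloisField 3 2) := by
    rw [FiniteField.isSquare_neg_one_iff, hF]; norm_num
  have hne : i ≠ -i := by
    intro h
    have h0 : i = 0 := by linear_combination i * h3 - h
    rw [h0] at hi
    simp at hi
  have hev : ∀ x : GaloisField 3 2, Polynomial.aeval x
        ((X : Polynomial (ZMod 3)) ^ 12 + X ^ 11 + C 2 * X ^ 4 + C 2 * X ^ 3 + C 2) = -1 := by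
    intro x
    simp only [map_add, map_mul, map_pow, aeval_X, map_ofNat]
    linear_combination (x ^ 3 + x ^ 2) * hpow x + (x ^ 4 + x ^ 3 + 1) * h3
  have hset : {p : GaloisField 3 2 × GaloisField 3 2 | p.2 ^ 2 = Polynomial.aeval p.1
        ((X : Polynomial (ZMod 3)) ^ 12 + X ^ 11 + C 2 * X ^ 4 + C 2 * X ^ 3 + C 2)}
      = Set.univ ×ˢ {i, -i} := by
    ext ⟨x, y⟩
    simp only [Set.mem_setOf_eq, hev, Set.mem_prod, Set.mem_univ, true_and, Set.mem_insert_iff,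
      Set.mem_singleton_iff]
    rw [hi, ← sq, sq_eq_sq_iff_eq_or_eq_neg]
  change Nat.card (Set.Elem {p : GaloisField 3 2 × GaloisField 3 2 | p.2 ^ 2 = Polynomial.aeval p.1
        ((X : Polynomial (ZMod 3)) ^ 12 + X ^ 11 + C 2 * X ^ 4 + C 2 * X ^ 3 + C 2)}) = 18
  rw [Nat.card_coe_set_eq, hset, Set.ncard_prod, Set.ncard_pair hne, Set.ncard_univ, hcard]
end

section
/- Let F = x y z³ + (x³ + 2 x y² + y³) z² + (2 x² y² + 2 x y³) z + x⁵ + 2 x⁴ y + x² y³ + 2 x y⁴ + y⁵, a homogeneous polynomial of degree 5 with coefficients in F_3. The number of points of the projective plane ℙ²(F_9) at which F vanishes is exactly 29. (The unique singular point (0:0:1) of V(F) is a split node, so the normalization of V(F) is a genus-five trigonal curve over F_3 with exactly 30 F_9-rational points.) -/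
/-- The quintic as a function on a commutative ring. -/
def quinticF {R : Type*} [CommRing R] (x y z : R) : R :=
  x * y * z ^ 3 + (x ^ 3 + 2 * x * y ^ 2 + y ^ 3) * z ^ 2
      + (2 * x ^ 2 * y ^ 2 + 2 * x * y ^ 3) * z
      + x ^ 5 + 2 * x ^ 4 * y + x ^ 2 * y ^ 3
      + 2 * x * y ^ 4 + y ^ 5

lemma quinticF_smul {R : Type*} [CommRing R] (a x y z : R) :
    quinticF (a * x) (a * y) (a * z) = a ^ 5 * quinticF x y z := by
  unfold quinticF; ring

lemma quinticF_map {R S : Type*} [CommRing R] [CommRing S] (f : R →+* S) (x y z : R) :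
    quinticF (f x) (f y) (f z) = f (quinticF x y z) := by
  have h2 : f 2 = 2 := map_ofNat f 2
  simp [quinticF, h2]

/-- Normalized representatives of points of the projective plane. -/
def normVec {R : Type*} [CommRing R] : (R × R) ⊕ (R ⊕ Unit) → Fin 3 → R
  | .inl (y, z) => ![1, y, z]
  | .inr (.inl z) => ![0, 1, z]
  | .inr (.inr _) => ![0, 0, 1]

lemma normVec_ne {L : Type*} [Field L] (n : (L × L) ⊕ (L ⊕ Unit)) : normVec n ≠ 0 := by
  intro h
  rcases n with ⟨y, z⟩ | z | u
  · simpa [normVec] using congrFun h 0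
  · simpa [normVec] using congrFun h 1
  · simpa [normVec] using congrFun h 2

lemma normVec_bij {L : Type*} [Field L] :
    Function.Bijective (fun n : (L × L) ⊕ (L ⊕ Unit) =>
      Projectivization.mk L (normVec n) (normVec_ne n)) := by
  constructor
  · intro n m h
    rw [Projectivization.mk_eq_mk_iff'] at h
    obtain ⟨a, ha⟩ := h
    have h0 := congrFun ha 0
    have h1 := congrFun ha 1
    have h2 := congrFun ha 2
    rcases n with ⟨y, z⟩ | z | u <;> rcases m with ⟨yb, zb⟩ | zb | ub <;>
      simp [normVec] at h0 h1 h2 ⊢ <;> simp_all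
  · intro P
    induction P using Projectivization.ind with
    | h v hv =>
    by_cases h0 : v 0 = 0
    · by_cases h1 : v 1 = 0
      · have h2 : v 2 ≠ 0 := by
          intro h2
          apply hv
          ext i
          fin_cases i <;> simp [h0, h1, h2]
        refine ⟨.inr (.inr ()), ?_⟩
        simp only [Projectivization.mk_eq_mk_iff']
        refine ⟨(v 2)⁻¹, ?_⟩
        ext i
        fin_cases i <;> simp [normVec, h0, h1, h2]
      · refine ⟨.inr (.inl ((v 1)⁻¹ * v 2)), ?_⟩
        simp only [Projectivization.mk_eq_mk_iff']
        refine ⟨(v 1)⁻¹, ?_⟩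
        ext i
        fin_cases i <;> simp [normVec, h0, h1]
    · refine ⟨.inl ((v 0)⁻¹ * v 1, (v 0)⁻¹ * v 2), ?_⟩
      simp only [Projectivization.mk_eq_mk_iff']
      refine ⟨(v 0)⁻¹, ?_⟩
      ext i
      fin_cases i <;> simp [normVec, h0]

lemma quinticF_rep {L : Type*} [Field L] (v : Fin 3 → L) (hv : v ≠ 0) :
    quinticF (v 0) (v 1) (v 2) = 0 ↔
      quinticF ((Projectivization.mk L v hv).rep 0) ((Projectivization.mk L v hv).rep 1)
        ((Projectivization.mk L v hv).rep 2) = 0 := by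
  obtain ⟨a, ha⟩ := Projectivization.exists_smul_eq_mk_rep L v hv
  have ha0 : (a : L) ≠ 0 := a.ne_zero
  have e : ∀ i, (Projectivization.mk L v hv).rep i = a * v i := by
    intro i; rw [← ha]; rfl
  rw [e, e, e, quinticF_smul]
  simp [ha0]

/-- A computable model of the field with nine elements. -/
abbrev F9Model := QuadraticAlgebra (ZMod 3) (-1) 0

instance : Fact (∀ r : ZMod 3, r ^ 2 ≠ -1 + 0 * r) := ⟨by decide⟩

/-- Coordinates on the model. -/
abbrev pairF9 (p : ZMod 3 × ZMod 3) : F9Model := ⟨p.1, p.2⟩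

lemma model_card : Nat.card F9Model = 9 := by
  rw [Nat.card_congr (QuadraticAlgebra.equivProd (-1 : ZMod 3) 0)]
  simp

theorem model_equiv : Nonempty (F9Model ≃+* GaloisField 3 2) := by
  have : Finite F9Model := Nat.finite_of_card_ne_zero (by rw [model_card]; norm_num)
  have := Fintype.ofFinite F9Model
  have := Fintype.ofFinite (GaloisField 3 2)
  refine ⟨FiniteField.ringEquivOfCardEq ?_⟩
  rw [← Nat.card_eq_fintype_card, ← Nat.card_eq_fintype_card, model_card, GaloisField.card 3 2 (by norm_num)]
  norm_num

/-- Vanishing predicate on normalized points. -/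
abbrev vanishes {R : Type*} [CommRing R] (n : (R × R) ⊕ (R ⊕ Unit)) : Prop :=
  quinticF (normVec n 0) (normVec n 1) (normVec n 2) = 0

/-- Coordinates for normalized points over the model. -/
abbrev Pts := ((ZMod 3 × ZMod 3) × (ZMod 3 × ZMod 3)) ⊕ ((ZMod 3 × ZMod 3) ⊕ Unit)

/-- The point equivalence. -/
def ptsEquiv : Pts ≃ (F9Model × F9Model) ⊕ (F9Model ⊕ Unit) :=
  let e := (QuadraticAlgebra.equivProd (-1 : ZMod 3) 0).symm
  Equiv.sumCongr (Equiv.prodCongr e e) (Equiv.sumCongr e (Equiv.refl Unit))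

set_option maxRecDepth 100000 in
lemma model_count : Fintype.card {n : Pts // vanishes (ptsEquiv n)} = 29 := by
  decide +kernel

/-- The plane quintic
`F₂ = xyz³ + (x³ + 2xy² + y³)z² + (2x²y² + 2xy³)z + x⁵ + 2x⁴y + x²y³ + 2xy⁴ + y⁵`
(split node case) has exactly `29` zeros in `ℙ²(F₉)`, so its normalization is a
genus-five trigonal curve over `F₃` with `30` `F₉`-rational points. -/
theorem trigonal_example2_split_node_F9_count :
    Nat.card {P : Projectivization (GaloisField 3 2) (Fin 3 → GaloisField 3 2) //
      P.rep 0 * P.rep 1 * P.rep 2 ^ 3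
      + (P.rep 0 ^ 3 + 2 * P.rep 0 * P.rep 1 ^ 2 + P.rep 1 ^ 3) * P.rep 2 ^ 2
      + (2 * P.rep 0 ^ 2 * P.rep 1 ^ 2 + 2 * P.rep 0 * P.rep 1 ^ 3) * P.rep 2
      + P.rep 0 ^ 5 + 2 * P.rep 0 ^ 4 * P.rep 1 + P.rep 0 ^ 2 * P.rep 1 ^ 3
      + 2 * P.rep 0 * P.rep 1 ^ 4 + P.rep 1 ^ 5 = 0} = 29 := by
  obtain ⟨e⟩ := model_equiv
  have key : Nat.card {P : Projectivization (GaloisField 3 2) (Fin 3 → GaloisField 3 2) //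
      quinticF (P.rep 0) (P.rep 1) (P.rep 2) = 0} = 29 := by
    rw [← model_count, ← Nat.card_eq_fintype_card]
    symm
    refine Nat.card_congr ?_
    refine (ptsEquiv.subtypeEquiv (q := fun n => vanishes n) (fun _ => Iff.rfl)).trans ?_
    refine (Equiv.subtypeEquiv (q := fun n => vanishes n)
      (Equiv.sumCongr (Equiv.prodCongr e.toEquiv e.toEquiv)
        (Equiv.sumCongr e.toEquiv (Equiv.refl Unit))) ?_).trans ?_
    · intro n
      have h : ∀ i, normVec ((Equiv.sumCongr (Equiv.prodCongr e.toEquiv e.toEquiv)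
        (Equiv.sumCongr e.toEquiv (Equiv.refl Unit))) n) i = (e : F9Model →+* _) (normVec n i) := by
        intro i
        rcases n with ⟨y, z⟩ | z | u <;> fin_cases i <;> simp [normVec]
      simp only [vanishes]
      rw [h, h, h, quinticF_map]
      simp
    · exact (Equiv.ofBijective _ normVec_bij).subtypeEquiv
        (fun n => quinticF_rep (normVec n) (normVec_ne n))
  exact key
end

section
/- Let F = (x² − 2y²) z³ + (x(x² − 2y²) + x³ + y³) z² + x² y² z + 2 x⁵ + 2 x⁴ y + x³ y² + y⁵, a homogeneous polynomial of degree 5 with coefficients in F_3 (here 2 is a non-square in F_3). The number of points of the projective plane ℙ²(F_9) at which F vanishes is exactly 29. (The unique singular point (0:0:1) of V(F) is a node that is non-split over F_3 but split over F_9, so the normalization of V(F) is a genus-five trigonal curve over F_3 with exactly 30 F_9-rational points.) -/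
/-- The quintic form over an arbitrary commutative ring. -/
def quinticForm {R : Type*} [CommRing R] (x y z : R) : R :=
  (x ^ 2 - 2 * y ^ 2) * z ^ 3
      + (x * (x ^ 2 - 2 * y ^ 2) + x ^ 3 + y ^ 3) * z ^ 2
      + x ^ 2 * y ^ 2 * z
      + 2 * x ^ 5 + 2 * x ^ 4 * y + x ^ 3 * y ^ 2
      + y ^ 5

/-- A computable model of the field with nine elements. -/
abbrev NineModel := QuadraticAlgebra (ZMod 3) (-1) 0

instance nineModelFact : Fact (∀ r : ZMod 3, r ^ 2 ≠ (-1) + 0 * r) := ⟨by decide⟩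

instance nineModelFintype : Fintype NineModel :=
  Fintype.ofEquiv _ (QuadraticAlgebra.equivProd (-1 : ZMod 3) 0).symm

/-- The form in coordinates, Horner style, over the model. -/
def nineCheck (x y z : NineModel) : Bool :=
  let x2 := x * x
  let y2 := y * y
  let z2 := z * z
  let x3 := x2 * x
  let q := x2 + y2
  decide ((q * (z2 * z) + (x * q + x3 + y2 * y) * z2 + x2 * y2 * z
    - x3 * x2 - x2 * x2 * y + x3 * y2 + y2 * y2 * y) = 0)

theorem nineCheck_iff (x y z : NineModel) : nineCheck x y z = true ↔ quinticForm x y z = 0 := by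
  have h2 : (2 : NineModel) = -1 := by decide
  simp only [nineCheck, quinticForm, decide_eq_true_eq, h2]
  constructor <;> intro h <;> rw [← h] <;> ring

theorem nineCount :
    Fintype.card {t : NineModel × NineModel × NineModel //
      t ≠ 0 ∧ nineCheck t.1 t.2.1 t.2.2 = true} = 232 := by
  decide +kernel

theorem quinticForm_smul {R : Type*} [CommRing R] (u x y z : R) :
    quinticForm (u * x) (u * y) (u * z) = u ^ 5 * quinticForm x y z := by
  unfold quinticForm; ring

theorem quinticForm_map {R S : Type*} [CommRing R] [CommRing S] (f : R →+* S) (x y z : R) :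
    quinticForm (f x) (f y) (f z) = f (quinticForm x y z) := by
  have h2 : f 2 = 2 := map_ofNat f 2
  simp [quinticForm, h2]

theorem quintic_cone (K : Type*) [Field K] :
    Nat.card {v : Fin 3 → K // v ≠ 0 ∧ quinticForm (v 0) (v 1) (v 2) = 0} =
    Nat.card {P : Projectivization K (Fin 3 → K) //
      quinticForm (P.rep 0) (P.rep 1) (P.rep 2) = 0} * Nat.card Kˣ := by
  rw [← Nat.card_prod]
  symm
  refine Nat.card_congr (Equiv.ofBijective
    (fun p => ⟨(p.2 : K) • p.1.1.rep, ?_, ?_⟩) ⟨?_, ?_⟩)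
  · exact smul_ne_zero p.2.ne_zero p.1.1.rep_nonzero
  · simp only [Pi.smul_apply, smul_eq_mul, quinticForm_smul, p.1.2, mul_zero]
  · rintro ⟨⟨P, hP⟩, u⟩ ⟨⟨Q, hQ⟩, w⟩ h
    have h' : (u : K) • P.rep = (w : K) • Q.rep := congrArg Subtype.val h
    have hPQ : P = Q := by
      rw [← P.mk_rep, ← Q.mk_rep, Projectivization.mk_eq_mk_iff]
      refine ⟨u⁻¹ * w, ?_⟩
      rw [mul_smul, inv_smul_eq_iff]
      exact h'.symm
    subst hPQ
    have : (u : K) = w := smul_left_injective K P.rep_nonzero h'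
    have : u = w := Units.ext this
    subst this
    rfl
  · rintro ⟨v, hv, hF⟩
    obtain ⟨a, ha⟩ := Projectivization.exists_smul_eq_mk_rep K v hv
    refine ⟨⟨⟨Projectivization.mk K v hv, ?_⟩, a⁻¹⟩, ?_⟩
    · rw [← ha]
      simp only [Pi.smul_apply, Units.smul_def, smul_eq_mul, quinticForm_smul, hF, mul_zero]
    · apply Subtype.ext
      change (a⁻¹ : Kˣ) • (Projectivization.mk K v hv).rep = v
      rw [← ha, inv_smul_smul]

theorem quintic_cone_count (K : Type*) [Field K] (e : NineModel ≃+* K) :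
    Nat.card {v : Fin 3 → K // v ≠ 0 ∧ quinticForm (v 0) (v 1) (v 2) = 0} = 232 := by
  rw [← nineCount, ← Nat.card_eq_fintype_card]
  symm
  refine Nat.card_congr (Equiv.ofBijective
    (fun t => ⟨![e t.1.1, e t.1.2.1, e t.1.2.2], ?_, ?_⟩) ⟨?_, ?_⟩)
  · intro h
    apply t.2.1
    have h0 := congrFun h 0
    have h1 := congrFun h 1
    have h2 := congrFun h 2
    simp at h0 h1 h2
    exact Prod.ext h0 (Prod.ext h1 h2)
  · have := quinticForm_map (e : NineModel →+* K) t.1.1 t.1.2.1 t.1.2.2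
    rw [(nineCheck_iff _ _ _).1 t.2.2, map_zero] at this
    exact this
  · rintro ⟨⟨a, b, c⟩, h⟩ ⟨⟨a', b', c'⟩, h'⟩ hh
    have h3 := congrArg Subtype.val hh
    have h0 := congrFun h3 0
    have h1 := congrFun h3 1
    have h2 := congrFun h3 2
    simp at h0 h1 h2
    subst h0 h1 h2
    rfl
  · rintro ⟨v, hv, hF⟩
    have hvv : ![v 0, v 1, v 2] = v := by
      ext i; fin_cases i <;> rfl
    refine ⟨⟨(e.symm (v 0), e.symm (v 1), e.symm (v 2)), ?_, ?_⟩, ?_⟩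
    · intro h
      apply hv
      simp only [Prod.ext_iff, Prod.fst_zero, Prod.snd_zero, map_eq_zero_iff e.symm e.symm.injective] at h
      rw [← hvv, h.1, h.2.1, h.2.2]
      ext i; fin_cases i <;> rfl
    · rw [nineCheck_iff]
      have := quinticForm_map (e.symm : K →+* NineModel) (v 0) (v 1) (v 2)
      rw [hF, map_zero] at this
      exact this
    · apply Subtype.ext
      simpa using hvv

/-- The plane quintic
`F₁₁ = (x² − 2y²)z³ + (x(x² − 2y²) + x³ + y³)z² + x²y²z + 2x⁵ + 2x⁴y + x³y² + y⁵`
(non-split node case, ε = 2) has exactly `29` zeros in `ℙ²(F₉)`, so its normalization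
is a genus-five trigonal curve over `F₃` with `30` `F₉`-rational points. -/
theorem trigonal_example_nonsplit_node_F9_count :
    Nat.card {P : Projectivization (GaloisField 3 2) (Fin 3 → GaloisField 3 2) //
      (P.rep 0 ^ 2 - 2 * P.rep 1 ^ 2) * P.rep 2 ^ 3
      + (P.rep 0 * (P.rep 0 ^ 2 - 2 * P.rep 1 ^ 2) + P.rep 0 ^ 3 + P.rep 1 ^ 3) * P.rep 2 ^ 2
      + P.rep 0 ^ 2 * P.rep 1 ^ 2 * P.rep 2
      + 2 * P.rep 0 ^ 5 + 2 * P.rep 0 ^ 4 * P.rep 1 + P.rep 0 ^ 3 * P.rep 1 ^ 2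
      + P.rep 1 ^ 5 = 0} = 29 := by
  have hK : Nat.card (GaloisField 3 2) = 9 := by
    rw [GaloisField.card 3 2 (by norm_num)]; norm_num
  let _ : Fintype (GaloisField 3 2) := Fintype.ofFinite _
  have hM : Fintype.card NineModel = Fintype.card (GaloisField 3 2) := by
    rw [← Nat.card_eq_fintype_card (α := GaloisField 3 2), hK]
    decide +kernel
  have h1 := quintic_cone (GaloisField 3 2)
  rw [quintic_cone_count _ (FiniteField.ringEquivOfCardEq hM), Nat.card_units, hK] at h1
  change Nat.card {P : Projectivization (GaloisField 3 2) (Fin 3 → GaloisField 3 2) //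
      quinticForm (P.rep 0) (P.rep 1) (P.rep 2) = 0} = 29
  omega
end
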